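/- arXiv:1704.00955 — 2 statements merged into one kernel-verified Lean document; each statement's English description precedes it below -/
import Mathlib

section
/- Collapsing estimate with σ-derivatives of the data: for every 0 < ε < 1/2, set σ := (3/2 − ε)·ε and q := 2/((2−ε)(1/2−ε)). Then there is a constant C = C(ε) such that for every Schwartz Γ₀ on ℝ², the solution Γ(t) = e^{it(Δ_x−Δ_y)}Γ₀ satisfies ‖ |∇_x|^{1/2−ε} ρ_Γ ‖_{L^q(ℝ_t; L²(ℝ_x))} ≤ C ‖ |∇_{x,y}|^{σ} Γ₀ ‖_{L²(ℝ²)}. -/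
open MeasureTheory Complex SchwartzMap
open scoped ENNReal NNReal Real

noncomputable section

/-- 1D Fourier transform with the convention `f̂ ξ = ∫ e^{-iξx} f x dx`. -/
def FT1 (f : ℝ → ℂ) (ξ : ℝ) : ℂ :=
  ∫ x : ℝ, Complex.exp (-(Complex.I) * (ξ : ℂ) * (x : ℂ)) * f x

/-- 1D inverse Fourier transform. -/
def IFT1 (g : ℝ → ℂ) (x : ℝ) : ℂ :=
  (2 * (Real.pi : ℂ))⁻¹ * ∫ ξ : ℝ, Complex.exp (Complex.I * (ξ : ℂ) * (x : ℂ)) * g ξ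

/-- 2D Fourier transform (curried kernels). -/
def FT2 (f : ℝ → ℝ → ℂ) (ξ η : ℝ) : ℂ :=
  ∫ x : ℝ, ∫ y : ℝ, Complex.exp (-(Complex.I) * ((ξ : ℂ) * x + (η : ℂ) * y)) * f x y

/-- 2D inverse Fourier transform. -/
def IFT2 (g : ℝ → ℝ → ℂ) (x y : ℝ) : ℂ :=
  ((2 * (Real.pi : ℂ)) ^ 2)⁻¹ *
    ∫ ξ : ℝ, ∫ η : ℝ, Complex.exp (Complex.I * ((ξ : ℂ) * x + (η : ℂ) * y)) * g ξ η

/-- Free propagator `e^{it(Δ_x − Δ_y)}`, Fourier multiplier `e^{it(η²−ξ²)}`. -/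
def freeGamma (Γ₀ : ℝ → ℝ → ℂ) (t x y : ℝ) : ℂ :=
  IFT2 (fun ξ η => Complex.exp (Complex.I * (t : ℂ) * ((η : ℂ) ^ 2 - (ξ : ℂ) ^ 2)) * FT2 Γ₀ ξ η) x y

/-- Free propagator `e^{it(Δ_x + Δ_y)}`, Fourier multiplier `e^{−it(ξ²+η²)}`. -/
def freeLambda (Λ₀ : ℝ → ℝ → ℂ) (t x y : ℝ) : ℂ :=
  IFT2 (fun ξ η => Complex.exp (-(Complex.I) * (t : ℂ) * ((ξ : ℂ) ^ 2 + (η : ℂ) ^ 2)) * FT2 Λ₀ ξ η) x y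

/-- `|∇_x|^s`, Fourier multiplier `|ξ|^s` in one variable. -/
def absDx (s : ℝ) (f : ℝ → ℂ) (x : ℝ) : ℂ :=
  IFT1 (fun ξ => ((|ξ| ^ s : ℝ) : ℂ) * FT1 f ξ) x

/-- `|∇_{x,y}|^s`, Fourier multiplier `(ξ²+η²)^{s/2}` on `ℝ²`. -/
def absDxy (s : ℝ) (f : ℝ → ℝ → ℂ) (x y : ℝ) : ℂ :=
  IFT2 (fun ξ η => (((ξ ^ 2 + η ^ 2) ^ (s / 2) : ℝ) : ℂ) * FT2 f ξ η) x y

/-- `|∇_{x+y}|^s`, Fourier multiplier `(|ξ+η|/2)^s` on `ℝ²`. -/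
def absDxpy (s : ℝ) (f : ℝ → ℝ → ℂ) (x y : ℝ) : ℂ :=
  IFT2 (fun ξ η => (((|ξ + η| / 2) ^ s : ℝ) : ℂ) * FT2 f ξ η) x y

/-- `⟨∇_x⟩^s`, Fourier multiplier `(1+ξ²)^{s/2}` in one variable. -/
def japDx (s : ℝ) (f : ℝ → ℂ) (x : ℝ) : ℂ :=
  IFT1 (fun ξ => (((1 + ξ ^ 2) ^ (s / 2) : ℝ) : ℂ) * FT1 f ξ) x

/-- `⟨∇_{x,y}⟩^s`, Fourier multiplier `(1+ξ²+η²)^{s/2}` on `ℝ²`. -/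
def japDxy (s : ℝ) (f : ℝ → ℝ → ℂ) (x y : ℝ) : ℂ :=
  IFT2 (fun ξ η => (((1 + ξ ^ 2 + η ^ 2) ^ (s / 2) : ℝ) : ℂ) * FT2 f ξ η) x y

/-- `L²` norm of a kernel on `ℝ²`. -/
def L2K (f : ℝ → ℝ → ℂ) : ℝ≥0∞ :=
  eLpNorm (fun p : ℝ × ℝ => f p.1 p.2) 2 volume

/-- `L²` norm on `ℝ`. -/
def L2F (f : ℝ → ℂ) : ℝ≥0∞ := eLpNorm f 2 volume

/-- Mixed norm `L^q(μ(dt)) L^r(dx)` for a function of `(t,x)`. -/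
def MixedN2 (μ : Measure ℝ) (q r : ℝ≥0∞) (u : ℝ → ℝ → ℂ) : ℝ≥0∞ :=
  eLpNorm (fun t => (eLpNorm (u t) r volume).toReal) q μ

/-- Mixed norm `L^q(μ(dt)) L^r(dx) L^s(dy)` for a function of `(t,x,y)`. -/
def MixedN3 (μ : Measure ℝ) (q r s : ℝ≥0∞) (u : ℝ → ℝ → ℝ → ℂ) : ℝ≥0∞ :=
  eLpNorm (fun t => (eLpNorm (fun x => (eLpNorm (u t x) s volume).toReal) r volume).toReal) q μ

/-- Spacetime Fourier transform on `ℝ_t × ℝ_x`. -/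
def FTtx (u : ℝ → ℝ → ℂ) (τ ξ : ℝ) : ℂ :=
  ∫ t : ℝ, ∫ x : ℝ, Complex.exp (-(Complex.I) * ((τ : ℂ) * t + (ξ : ℂ) * x)) * u t x

/-- Spacetime Fourier transform on `ℝ_t × ℝ²`. -/
def FTtxy (u : ℝ → ℝ → ℝ → ℂ) (τ ξ η : ℝ) : ℂ :=
  ∫ t : ℝ, ∫ x : ℝ, ∫ y : ℝ,
    Complex.exp (-(Complex.I) * ((τ : ℂ) * t + (ξ : ℂ) * x + (η : ℂ) * y)) * u t x y

/-- Bourgain space norm `X^b` associated to `𝐒 = (1/i)∂_t − Δ_x − Δ_y`. -/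
def XbNorm (b : ℝ) (u : ℝ → ℝ → ℝ → ℂ) : ℝ≥0∞ :=
  eLpNorm (fun p : ℝ × ℝ × ℝ =>
    (((1 + |p.1 + p.2.1 ^ 2 + p.2.2 ^ 2|) ^ b : ℝ) : ℂ) * FTtxy u p.1 p.2.1 p.2.2) 2 volume

/-- Duhamel solution of `𝐒_± Γ = F` with data `Γ₀`. -/
def duhamelGamma (Γ₀ : ℝ → ℝ → ℂ) (F : ℝ → ℝ → ℝ → ℂ) (t x y : ℝ) : ℂ :=
  freeGamma Γ₀ t x y + Complex.I * ∫ s in (0:ℝ)..t, freeGamma (F s) (t - s) x y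

/-- Duhamel solution of `𝐒 Λ = F` with data `Λ₀`. -/
def duhamelLambda (Λ₀ : ℝ → ℝ → ℂ) (F : ℝ → ℝ → ℝ → ℂ) (t x y : ℝ) : ℂ :=
  freeLambda Λ₀ t x y + Complex.I * ∫ s in (0:ℝ)..t, freeLambda (F s) (t - s) x y


section Plancherel
open FourierTransform

variable {E : Type*} [NormedAddCommGroup E] [MeasurableSpace E] [BorelSpace E]
  [InnerProductSpace ℝ E] [FiniteDimensional ℝ E]

lemma integral_fourier_smul_eq_flip (φ : 𝓢(E, ℂ)) {f : E → ℂ} (hf : Integrable f) :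
    ∫ x, (𝓕 φ) x • f x = ∫ x, φ x • (𝓕 f) x := by
  have := VectorFourier.integral_fourierIntegral_smul_eq_flip (μ := volume) (ν := volume)
    (L := innerₗ E) (f := φ) (g := f) Real.continuous_fourierChar
    (by exact continuous_inner) φ.integrable hf
  rw [SchwartzMap.fourier_coe]
  rw [flip_innerₗ] at this
  exact this

lemma continuous_fourier {f : E → ℂ} (hf : Integrable f) : Continuous (𝓕 f) :=
  VectorFourier.fourierIntegral_continuous Real.continuous_fourierChar
    (by exact continuous_inner) hf

lemma integral_smul_fourier_Lp (h : Lp (α := E) ℂ 2) (φ : 𝓢(E, ℂ)) :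
    ∫ x, φ x • (𝓕 h : Lp (α := E) ℂ 2) x = ∫ x, (𝓕 φ) x • h x := by
  have h1 := DFunLike.congr_fun (Lp.fourier_toTemperedDistribution_eq h) φ
  rw [Lp.toTemperedDistribution_apply, TemperedDistribution.fourier_apply,
    Lp.toTemperedDistribution_apply] at h1
  exact h1.symm

/-- If `h ∈ L²` agrees almost everywhere with an integrable `f`, then its `L²` Fourier transform
is given by the Fourier integral of `f`. -/
lemma coeFn_fourier_ae_eq {f : E → ℂ} (hf : Integrable f) (h : Lp (α := E) ℂ 2)
    (hfh : h =ᵐ[volume] f) : ⇑(𝓕 h : Lp (α := E) ℂ 2) =ᵐ[volume] 𝓕 f := by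
  apply ae_eq_of_integral_contDiff_smul_eq
  · exact (Lp.memLp _).locallyIntegrable (by norm_num)
  · exact (continuous_fourier hf).locallyIntegrable
  intro g g_smooth g_cpt
  have hg₁ : HasCompactSupport (Complex.ofRealCLM ∘ g) := g_cpt.comp_left rfl
  have hg₂ : ContDiff ℝ (⊤ : ℕ∞) (Complex.ofRealCLM ∘ g) :=
    Complex.ofRealCLM.contDiff.comp g_smooth
  have h2 : ∫ x, (𝓕 (hg₁.toSchwartzMap hg₂)) x • h x
      = ∫ x, (𝓕 (hg₁.toSchwartzMap hg₂)) x • f x := by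
    apply integral_congr_ae
    filter_upwards [hfh] with x hx
    rw [hx]
  have h3 := (integral_smul_fourier_Lp h (hg₁.toSchwartzMap hg₂)).trans
    (h2.trans (integral_fourier_smul_eq_flip _ hf))
  simpa using h3

/-- Plancherel's theorem for functions in `L¹ ∩ L²`. -/
lemma eLpNorm_two_fourier {f : E → ℂ} (hf1 : Integrable f) (hf2 : MemLp f 2) :
    eLpNorm (𝓕 f) 2 volume = eLpNorm f 2 volume := by
  rw [← eLpNorm_congr_ae (coeFn_fourier_ae_eq hf1 (hf2.toLp f) hf2.coeFn_toLp),
    ← eLpNorm_congr_ae hf2.coeFn_toLp]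
  have := Lp.norm_fourier_eq (hf2.toLp f)
  rw [Lp.norm_def, Lp.norm_def] at this
  exact (ENNReal.toReal_eq_toReal_iff' (Lp.eLpNorm_ne_top _) (Lp.eLpNorm_ne_top _)).1 this

/-- Plancherel's theorem for the inverse Fourier transform on `L¹ ∩ L²`. -/
lemma eLpNorm_two_fourierInv {f : E → ℂ} (hf1 : Integrable f) (hf2 : MemLp f 2) :
    eLpNorm (𝓕⁻ f) 2 volume = eLpNorm f 2 volume := by
  rw [← eLpNorm_two_fourier hf1 hf2]
  have : (𝓕⁻ f) = (𝓕 f) ∘ Neg.neg := by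
    ext w
    exact Real.fourierInv_eq_fourier_neg f w
  rw [this]
  exact eLpNorm_comp_measurePreserving (continuous_fourier hf1).aestronglyMeasurable
    (Measure.measurePreserving_neg volume)

end Plancherel

/-- Minkowski's integral inequality for nonnegative functions. -/
lemma lintegral_rpow_lintegral_le {α β : Type*} [MeasurableSpace α] [MeasurableSpace β]
    {μ : Measure α} {ν : Measure β} [SigmaFinite μ] [SFinite ν] {p : ℝ} (hp : 1 ≤ p)
    {f : α → β → ℝ≥0∞} (hf : Measurable (Function.uncurry f)) :
    (∫⁻ a, (∫⁻ b, f a b ∂ν) ^ p ∂μ) ^ (1 / p) ≤ ∫⁻ b, (∫⁻ a, f a b ^ p ∂μ) ^ (1 / p) ∂ν := by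
  have hp0 : 0 < p := by linarith
  rcases hp.eq_or_lt with rfl | hp1
  · simpa using (lintegral_lintegral_swap hf.aemeasurable).le
  set B := ∫⁻ b, (∫⁻ a, f a b ^ p ∂μ) ^ (1 / p) ∂ν with hB
  set h : α → ℝ≥0∞ := fun a => ∫⁻ b, f a b ∂ν with hh
  have hmeas : Measurable h := hf.lintegral_prod_right'
  let S := spanningSets μ
  let u : ℕ → α → ℝ≥0∞ := fun n => (S n).indicator (fun a => min (h a) n)
  have hum : ∀ n, Measurable (u n) := fun n =>
    (hmeas.min measurable_const).indicator (measurableSet_spanningSets μ n)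
  have hule : ∀ n a, u n a ≤ h a := fun n a => by
    refine Set.indicator_le (fun a _ => min_le_left _ _) a
  have hpq : p.HolderConjugate (p / (p - 1)) := Real.HolderConjugate.conjExponent hp1
  have key : ∀ n, (∫⁻ a, u n a ^ p ∂μ) ≤ B ^ p := by
    intro n
    set A := ∫⁻ a, u n a ^ p ∂μ with hA
    have hAtop : A ≠ ∞ := by
      have : A ≤ ∫⁻ a, (S n).indicator (fun _ => (n : ℝ≥0∞) ^ p) a ∂μ := by
        apply lintegral_mono
        intro a
        by_cases ha : a ∈ S n
        · simp only [u, Set.indicator_of_mem ha]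
          gcongr
          exact min_le_right _ _
        · simp [u, Set.indicator_of_notMem ha, hp0]
      refine ne_top_of_le_ne_top ?_ this
      rw [lintegral_indicator (measurableSet_spanningSets μ n), setLIntegral_const]
      exact ENNReal.mul_ne_top (by simp [hp0.le]) (measure_spanningSets_lt_top μ n).ne
    have h1 : A ≤ B * A ^ (1 / (p / (p - 1))) := by
      calc A ≤ ∫⁻ a, (∫⁻ b, f a b ∂ν) * u n a ^ (p - 1) ∂μ := by
            apply lintegral_mono
            intro a
            calc u n a ^ p = u n a * u n a ^ (p - 1) := by
                  conv_lhs => rw [show p = 1 + (p - 1) by ring]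
                  rw [ENNReal.rpow_add_of_nonneg _ _ (by norm_num) (by linarith), ENNReal.rpow_one]
              _ ≤ _ := mul_le_mul_left (hule n a) _
        _ = ∫⁻ a, ∫⁻ b, f a b * u n a ^ (p - 1) ∂ν ∂μ := by
            congr with a
            rw [lintegral_mul_const]
            exact hf.of_uncurry_left
        _ = ∫⁻ b, ∫⁻ a, f a b * u n a ^ (p - 1) ∂μ ∂ν := by
            apply lintegral_lintegral_swap
            apply Measurable.aemeasurable
            exact hf.mul (((hum n).comp measurable_fst).pow_const _)
        _ ≤ ∫⁻ b, (∫⁻ a, f a b ^ p ∂μ) ^ (1 / p) * A ^ (1 / (p / (p - 1))) ∂ν := by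
            apply lintegral_mono
            intro b
            refine (ENNReal.lintegral_mul_le_Lp_mul_Lq μ hpq (f := fun a => f a b)
              (g := fun a => u n a ^ (p - 1))
              (by fun_prop) ((hum n).pow_const _).aemeasurable).trans_eq ?_
            congr 2
            apply lintegral_congr
            intro a
            rw [← ENNReal.rpow_mul]
            congr 1
            field_simp [sub_ne_zero.2 hp1.ne']
        _ = B * A ^ (1 / (p / (p - 1))) := by
            rw [lintegral_mul_const]
            refine Measurable.pow_const ?_ _
            exact Measurable.lintegral_prod_left' (f := fun z : α × β => f z.1 z.2 ^ p)
              (hf.pow_const p)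
    rcases eq_or_ne A 0 with h0 | h0
    · rw [h0]; exact zero_le
    have h2 : A ^ (1 / p) ≤ B := by
      have e : A ^ (1 / p) * A ^ (1 / (p / (p - 1))) = A := by
        rw [← ENNReal.rpow_add _ _ h0 hAtop]
        have : 1 / p + 1 / (p / (p - 1)) = 1 := by field_simp; ring
        rw [this, ENNReal.rpow_one]
      have hpos : 0 ≤ 1 / (p / (p - 1)) := by have := hpq.symm.pos; positivity
      refine (ENNReal.mul_le_mul_iff_left (c := A ^ (1 / (p / (p - 1)))) ?_ ?_).1 (e.le.trans h1)
      · exact (ENNReal.rpow_pos (pos_iff_ne_zero.2 h0) hAtop).ne'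
      · exact ENNReal.rpow_ne_top_of_nonneg hpos hAtop
    calc A = (A ^ (1 / p)) ^ p := by rw [← ENNReal.rpow_mul]; simp [hp0.ne']
      _ ≤ B ^ p := by gcongr
  have hmono : ∀ a, Monotone fun n => u n a ^ p := by
    intro a n m hnm
    dsimp only
    gcongr
    simp only [u]
    refine (Set.indicator_le_indicator_of_subset (monotone_spanningSets μ hnm)
      (fun _ => zero_le) a).trans ?_
    apply Set.indicator_le_indicator
    gcongr
  have hsup : ∀ a, h a ^ p = ⨆ n, u n a ^ p := by
    intro a
    refine (iSup_eq_of_tendsto (hmono a) ?_).symm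
    refine (ENNReal.continuous_rpow_const.tendsto _).comp ?_
    have h1 : Filter.Tendsto (fun n : ℕ => min (h a) (n : ℝ≥0∞)) Filter.atTop
        (nhds (min (h a) ∞)) := tendsto_const_nhds.min ENNReal.tendsto_nat_nhds_top
    rw [min_eq_left le_top] at h1
    refine h1.congr' ?_
    filter_upwards [eventually_mem_spanningSets μ a] with n hn
    exact (Set.indicator_of_mem (s := S n) hn (fun a => min (h a) (n : ℝ≥0∞))).symm
  rw [one_div, ENNReal.rpow_inv_le_iff hp0]
  calc ∫⁻ a, h a ^ p ∂μ = ∫⁻ a, ⨆ n, u n a ^ p ∂μ := by simp_rw [hsup]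
    _ = ⨆ n, ∫⁻ a, u n a ^ p ∂μ := by
        apply lintegral_iSup (fun n => (hum n).pow_const _)
        exact fun n m hnm a => hmono a hnm
    _ ≤ B ^ p := iSup_le key

section Sobolev
open FourierTransform

lemma eLpNorm_two_rpow_two {α : Type*} [MeasurableSpace α] {μ : Measure α} (f : α → ℂ) :
    eLpNorm f 2 μ = (∫⁻ x, ‖f x‖ₑ ^ (2 : ℝ) ∂μ) ^ (1 / 2 : ℝ) := by
  rw [eLpNorm_eq_lintegral_rpow_enorm_toReal (by norm_num) (by norm_num)]
  simp

/-- `L^q` bound for the Fourier transform of a function restricted to a set of finite measure,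
by interpolation between `L²` and `L^∞`. -/
lemma lintegral_fourier_indicator_rpow_le {q : ℝ} (hq : 2 ≤ q) {G : ℝ → ℂ} (hG1 : Integrable G)
    (hG2 : MemLp G 2) {A : Set ℝ} (hA : MeasurableSet A) :
    (∫⁻ x, ‖𝓕 (A.indicator G) x‖ₑ ^ q) ^ (1 / q) ≤
      volume A ^ (1 / 2 - 1 / q) * (∫⁻ x in A, ‖G x‖ₑ ^ (2 : ℝ)) ^ (1 / 2 : ℝ) := by
  set N := (∫⁻ x in A, ‖G x‖ₑ ^ (2 : ℝ)) ^ (1 / 2 : ℝ) with hN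
  have hq0 : 0 < q := by linarith
  have hsup : ∀ x, ‖𝓕 (A.indicator G) x‖ₑ ≤ volume A ^ (1 / 2 : ℝ) * N := by
    intro x
    calc ‖𝓕 (A.indicator G) x‖ₑ ≤ ∫⁻ v, ‖A.indicator G v‖ₑ := by
          rw [Real.fourier_eq]
          refine (enorm_integral_le_lintegral_enorm _).trans_eq ?_
          congr with v
          rw [← ofReal_norm, Circle.norm_smul, ofReal_norm]
      _ = ∫⁻ v in A, 1 * ‖G v‖ₑ := by
          rw [← lintegral_indicator hA]
          congr with v
          rw [enorm_indicator_eq_indicator_enorm]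
          simp
      _ ≤ (∫⁻ v in A, 1 ^ (2 : ℝ)) ^ (1 / 2 : ℝ) * N :=
          ENNReal.lintegral_mul_le_Lp_mul_Lq _ (Real.HolderConjugate.two_two)
            aemeasurable_const hG1.aestronglyMeasurable.enorm.restrict
      _ = _ := by simp
  have hL2 : ∫⁻ x, ‖𝓕 (A.indicator G) x‖ₑ ^ (2 : ℝ) = N ^ (2 : ℝ) := by
    have h := eLpNorm_two_fourier (hG1.indicator hA) (hG2.indicator hA)
    rw [eLpNorm_indicator_eq_eLpNorm_restrict hA, eLpNorm_two_rpow_two, eLpNorm_two_rpow_two,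
      ← hN] at h
    rw [← h, ← ENNReal.rpow_mul]
    norm_num
  have hmain : ∫⁻ x, ‖𝓕 (A.indicator G) x‖ₑ ^ q ≤
      (volume A ^ (1 / 2 : ℝ) * N) ^ (q - 2) * N ^ (2 : ℝ) := by
    calc ∫⁻ x, ‖𝓕 (A.indicator G) x‖ₑ ^ q
        ≤ ∫⁻ x, (volume A ^ (1 / 2 : ℝ) * N) ^ (q - 2) * ‖𝓕 (A.indicator G) x‖ₑ ^ (2 : ℝ) := by
          apply lintegral_mono
          intro x
          dsimp only
          conv_lhs => rw [show q = (q - 2) + 2 by ring]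
          rw [ENNReal.rpow_add_of_nonneg _ _ (by linarith) (by norm_num)]
          gcongr
          exact hsup x
      _ = _ := by
          rw [lintegral_const_mul _ (by
            exact ((continuous_fourier (hG1.indicator hA)).enorm.measurable.pow_const _)), hL2]
  calc (∫⁻ x, ‖𝓕 (A.indicator G) x‖ₑ ^ q) ^ (1 / q)
      ≤ ((volume A ^ (1 / 2 : ℝ) * N) ^ (q - 2) * N ^ (2 : ℝ)) ^ (1 / q) := by
        gcongr
    _ = (volume A ^ ((q - 2) / 2) * N ^ q) ^ (1 / q) := by
        congr 1
        rw [ENNReal.mul_rpow_of_nonneg _ _ (by linarith : 0 ≤ q - 2), mul_assoc,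
          ← ENNReal.rpow_add_of_nonneg _ _ (by linarith) (by norm_num), ← ENNReal.rpow_mul]
        congr 2 <;> ring
    _ = volume A ^ (1 / 2 - 1 / q) * N := by
        rw [ENNReal.mul_rpow_of_nonneg _ _ (by positivity), ← ENNReal.rpow_mul, ← ENNReal.rpow_mul]
        have h1 : (q - 2) / 2 * (1 / q) = 1 / 2 - 1 / q := by field_simp
        have h2 : q * (1 / q) = 1 := by field_simp
        rw [h1, h2, ENNReal.rpow_one]

/-- One-dimensional Sobolev embedding on the Fourier side, with an inhomogeneous weight
bounded below by `max (K²/4) ξ²`. -/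
lemma exists_lintegral_fourier_rpow_le {q σ : ℝ} (hq : 2 ≤ q) (hσ : 1 / 2 - 1 / q < σ) :
    ∃ C : ℝ≥0∞, C ≠ ∞ ∧ ∀ (G : ℝ → ℂ) (w : ℝ → ℝ) (K : ℝ), 0 < K → Integrable G → MemLp G 2 →
      (∀ ξ, K ^ 2 / 4 ≤ w ξ) → (∀ ξ, ξ ^ 2 ≤ w ξ) →
      (∫⁻ x, ‖𝓕 G x‖ₑ ^ q) ^ (1 / q) ≤ C * ENNReal.ofReal (K ^ (1 / 2 - 1 / q - σ)) *
        (∫⁻ ξ, ENNReal.ofReal (w ξ ^ σ) * ‖G ξ‖ₑ ^ (2 : ℝ)) ^ (1 / 2 : ℝ) := by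
  have hq0 : 0 < q := by linarith
  set a := 1 / 2 - 1 / q with ha
  have ha0 : 0 ≤ a := by
    rw [ha, sub_nonneg]; gcongr
  have hσ0 : 0 < σ := by linarith
  set θ : ℝ := 2 ^ (a - σ) with hθ
  have hθ0 : 0 < θ := by positivity
  have hθ1 : θ < 1 := Real.rpow_lt_one_of_one_lt_of_neg (by norm_num) (by linarith)
  refine ⟨ENNReal.ofReal (2 ^ (a + σ)) * ∑' j : ℕ, ENNReal.ofReal θ ^ j, ?_, ?_⟩
  · refine ENNReal.mul_ne_top ENNReal.ofReal_ne_top ?_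
    rw [ENNReal.tsum_geometric]
    simpa [tsub_eq_zero_iff_le] using hθ1
  intro G w K hK hG1 hG2 hw1 hw2
  set W := (∫⁻ ξ, ENNReal.ofReal (w ξ ^ σ) * ‖G ξ‖ₑ ^ (2 : ℝ)) ^ (1 / 2 : ℝ) with hW
  let A : ℕ → Set ℝ := disjointed fun j => Metric.ball (0 : ℝ) (2 ^ j * K)
  have hAm : ∀ j, MeasurableSet (A j) := fun j =>
    MeasurableSet.disjointed (fun _ => measurableSet_ball) j
  have hAU : ⋃ j, A j = Set.univ := by
    rw [iUnion_disjointed, Set.eq_univ_iff_forall]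
    intro x
    obtain ⟨n, hn⟩ := pow_unbounded_of_one_lt (|x| / K) (one_lt_two)
    refine Set.mem_iUnion.2 ⟨n, ?_⟩
    rw [mem_ball_zero_iff, Real.norm_eq_abs]
    exact (div_lt_iff₀ hK).1 hn
  have hAv : ∀ j, volume (A j) ≤ ENNReal.ofReal (2 * (2 ^ j * K)) := fun j => by
    rw [← Real.volume_ball (0 : ℝ)]
    exact measure_mono (disjointed_subset _ j)
  have hAw : ∀ j, ∀ ξ ∈ A j, (2 ^ j * K / 2) ^ 2 ≤ w ξ := by
    intro j ξ hξ
    rcases j with _ | j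
    · convert hw1 ξ using 1; ring
    · refine le_trans ?_ (hw2 ξ)
      have : ξ ∉ Metric.ball (0 : ℝ) (2 ^ j * K) := by
        simp only [A, disjointed_eq_inter_compl, Set.mem_inter_iff, Set.mem_iInter] at hξ
        exact hξ.2 j (Nat.lt_succ_self j)
      rw [mem_ball_zero_iff, not_lt, Real.norm_eq_abs] at this
      rw [← sq_abs ξ]
      have e : (2 : ℝ) ^ (j + 1) * K / 2 = 2 ^ j * K := by ring
      rw [e]
      gcongr
  have hpiece : ∀ j, (∫⁻ x, ‖𝓕 ((A j).indicator G) x‖ₑ ^ q) ^ (1 / q) ≤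
      ENNReal.ofReal (2 ^ (a + σ)) * ENNReal.ofReal (K ^ (a - σ)) * W * ENNReal.ofReal θ ^ j := by
    intro j
    set b : ℝ := 2 ^ j * K with hb
    have hb0 : 0 < b := by positivity
    have h1 : ∫⁻ x in A j, ‖G x‖ₑ ^ (2 : ℝ) ≤ ENNReal.ofReal (((b / 2) ^ 2) ^ (-σ)) * W ^ (2 : ℝ) := by
      have : W ^ (2 : ℝ) = ∫⁻ ξ, ENNReal.ofReal (w ξ ^ σ) * ‖G ξ‖ₑ ^ (2 : ℝ) := by
        rw [hW, ← ENNReal.rpow_mul]; norm_num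
      rw [this, ← lintegral_const_mul' _ _ ENNReal.ofReal_ne_top]
      refine le_trans (setLIntegral_mono' (hAm j) ?_) (setLIntegral_le_lintegral _ _)
      intro x hx
      rw [← mul_assoc, ← ENNReal.ofReal_mul (by positivity)]
      refine le_mul_of_one_le_left' ?_
      rw [ENNReal.one_le_ofReal]
      have h2 : ((b / 2) ^ 2) ^ σ ≤ w x ^ σ := by
        gcongr
        exact hAw j x hx
      calc (1 : ℝ) = ((b / 2) ^ 2) ^ (-σ) * ((b / 2) ^ 2) ^ σ := by
            rw [← Real.rpow_add (by positivity)]; simp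
        _ ≤ _ := by gcongr
    have h2 : (∫⁻ x in A j, ‖G x‖ₑ ^ (2 : ℝ)) ^ (1 / 2 : ℝ) ≤
        ENNReal.ofReal ((b / 2) ^ (-σ)) * W := by
      refine (ENNReal.rpow_le_rpow h1 (by norm_num)).trans_eq ?_
      rw [ENNReal.mul_rpow_of_nonneg _ _ (by norm_num), ← ENNReal.rpow_mul,
        ENNReal.ofReal_rpow_of_nonneg (by positivity) (by norm_num), ← Real.rpow_mul (by positivity),
        ← Real.rpow_natCast, ← Real.rpow_mul (by positivity)]
      norm_num
      ring_nf
    refine (lintegral_fourier_indicator_rpow_le hq hG1 hG2 (hAm j)).trans ?_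
    calc volume (A j) ^ a * (∫⁻ x in A j, ‖G x‖ₑ ^ (2 : ℝ)) ^ (1 / 2 : ℝ)
        ≤ ENNReal.ofReal (2 * b) ^ a * (ENNReal.ofReal ((b / 2) ^ (-σ)) * W) := by
          gcongr
          exact hAv j
      _ = ENNReal.ofReal ((2 * b) ^ a * (b / 2) ^ (-σ)) * W := by
          rw [ENNReal.ofReal_rpow_of_nonneg (by positivity) ha0, ← mul_assoc,
            ← ENNReal.ofReal_mul (by positivity)]
      _ = ENNReal.ofReal (2 ^ (a + σ) * K ^ (a - σ) * θ ^ j) * W := by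
          congr 2
          rw [hb, Real.mul_rpow (by positivity) (by positivity),
            Real.mul_rpow (by positivity) (by positivity), Real.div_rpow (by positivity)
            (by positivity), Real.mul_rpow (by positivity) (by positivity), hθ,
            ← Real.rpow_natCast 2 j, ← Real.rpow_mul (by positivity), ← Real.rpow_mul (by positivity),
            ← Real.rpow_natCast, ← Real.rpow_mul (by positivity), Real.rpow_add (by positivity),
            sub_eq_add_neg, Real.rpow_add hK, div_eq_mul_inv, ← Real.rpow_neg (by positivity),
            neg_neg, add_mul, Real.rpow_add (by positivity)]
          ring_nf
      _ = _ := by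
          rw [ENNReal.ofReal_mul (by positivity), ENNReal.ofReal_mul (by positivity),
            ENNReal.ofReal_pow hθ0.le]
          ring
  have hsum : ∀ x, ‖𝓕 G x‖ₑ ≤ ∑' j, ‖𝓕 ((A j).indicator G) x‖ₑ := by
    intro x
    have hint : IntegrableOn (fun v => Real.fourierChar (-(inner ℝ v x)) • G v) (⋃ j, A j) := by
      rw [hAU, integrableOn_univ]
      exact (VectorFourier.fourierIntegral_convergent_iff Real.continuous_fourierChar
        (L := innerₗ ℝ) (by exact continuous_inner) x).2 hG1
    have h1 := hasSum_integral_iUnion hAm (disjoint_disjointed _) hint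
    rw [hAU, setIntegral_univ, ← Real.fourier_eq] at h1
    have h2 : ∀ j, ∫ v in A j, Real.fourierChar (-(inner ℝ v x)) • G v
        = 𝓕 ((A j).indicator G) x := by
      intro j
      rw [Real.fourier_eq, ← integral_indicator (hAm j)]
      congr with v
      by_cases hv : v ∈ A j <;> simp [hv]
    simp_rw [h2] at h1
    rw [← h1.tsum_eq]
    exact enorm_tsum_le_tsum_enorm
  calc (∫⁻ x, ‖𝓕 G x‖ₑ ^ q) ^ (1 / q)
      ≤ (∫⁻ x, (∫⁻ j, ‖𝓕 ((A j).indicator G) x‖ₑ ∂Measure.count) ^ q) ^ (1 / q) := by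
        simp_rw [lintegral_count]
        gcongr
        exact hsum _
    _ ≤ ∫⁻ j, (∫⁻ x, ‖𝓕 ((A j).indicator G) x‖ₑ ^ q) ^ (1 / q) ∂Measure.count := by
        apply lintegral_rpow_lintegral_le (by linarith)
        refine measurable_from_prod_countable_left fun j => ?_
        exact (continuous_fourier (hG1.indicator (hAm j))).enorm.measurable
    _ ≤ ∑' j, ENNReal.ofReal (2 ^ (a + σ)) * ENNReal.ofReal (K ^ (a - σ)) * W *
          ENNReal.ofReal θ ^ j := by
        rw [lintegral_count]
        exact ENNReal.tsum_le_tsum hpiece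
    _ = _ := by
        rw [ENNReal.tsum_mul_left]
        ring

end Sobolev

section Transforms
open FourierTransform

lemma lintegral_comp_smul_of_ne_zero {E : Type*} [NormedAddCommGroup E] [NormedSpace ℝ E]
    [MeasureSpace E] [BorelSpace E] [FiniteDimensional ℝ E]
    [(volume : Measure E).IsAddHaarMeasure] {r : ℝ} (hr : r ≠ 0) (F : E → ℝ≥0∞) :
    ∫⁻ x, F (r • x) = ENNReal.ofReal |(r ^ Module.finrank ℝ E)⁻¹| * ∫⁻ x, F x := by
  rw [← smul_eq_mul, ← lintegral_smul_measure, ← Measure.map_addHaar_smul volume hr]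
  exact (lintegral_map_equiv F (Homeomorph.smulOfNeZero r hr).toMeasurableEquiv).symm

lemma integrable_norm_rpow_mul_schwartz {E : Type*} [NormedAddCommGroup E] [NormedSpace ℝ E]
    [MeasureSpace E] [BorelSpace E] [FiniteDimensional ℝ E]
    [(volume : Measure E).IsAddHaarMeasure] (φ : 𝓢(E, ℂ)) {s : ℝ} (hs0 : 0 ≤ s) (hs1 : s ≤ 1) :
    Integrable (fun x => ((‖x‖ ^ s : ℝ) : ℂ) * φ x) ∧
      MemLp (fun x => ((‖x‖ ^ s : ℝ) : ℂ) * φ x) 2 := by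
  have hcont : Continuous (fun x => ((‖x‖ ^ s : ℝ) : ℂ) * φ x) := by
    have : Continuous fun x : E => ‖x‖ ^ s :=
      continuous_norm.rpow_const fun x => Or.inr hs0
    have := φ.continuous
    fun_prop
  have hpow : ∀ x : E, ‖x‖ ^ s ≤ 1 + ‖x‖ := by
    intro x
    rcases le_total ‖x‖ 1 with h | h
    · have := Real.rpow_le_one (norm_nonneg x) h hs0
      linarith [norm_nonneg x]
    · have := Real.rpow_le_rpow_of_exponent_le h hs1
      rw [Real.rpow_one] at this
      linarith
  have hle : ∀ x, ‖((‖x‖ ^ s : ℝ) : ℂ) * φ x‖ ≤ ‖φ x‖ + ‖x‖ ^ 1 * ‖φ x‖ := by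
    intro x
    rw [norm_mul, Complex.norm_real, Real.norm_of_nonneg (by positivity)]
    nlinarith [hpow x, norm_nonneg (φ x)]
  have hint : Integrable (fun x => ((‖x‖ ^ s : ℝ) : ℂ) * φ x) :=
    Integrable.mono' (φ.integrable.norm.add (φ.integrable_pow_mul volume 1))
      hcont.aestronglyMeasurable (Filter.Eventually.of_forall hle)
  refine ⟨hint, ?_⟩
  obtain ⟨C₀, -, h0⟩ := φ.decay 0 0
  obtain ⟨C₁, -, h1⟩ := φ.decay 1 0
  rw [memLp_two_iff_integrable_sq_norm hcont.aestronglyMeasurable]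
  have hb : ∀ x, ‖((‖x‖ ^ s : ℝ) : ℂ) * φ x‖ ≤ C₀ + C₁ := by
    intro x
    have a0 := h0 x
    have a1 := h1 x
    simp only [pow_zero, one_mul, norm_iteratedFDeriv_zero] at a0 a1
    linarith [hle x]
  refine Integrable.mono' (hint.norm.const_mul (C₀ + C₁))
    (hcont.norm.pow 2).aestronglyMeasurable (Filter.Eventually.of_forall fun x => ?_)
  rw [Real.norm_of_nonneg (by positivity), sq]
  gcongr
  exact hb x

lemma hasTemperateGrowth_cexp_I_mul :
    Function.HasTemperateGrowth fun x : ℝ => Complex.exp (Complex.I * (x : ℂ)) := by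
  have hd : ∀ n, iteratedDeriv n (fun x : ℝ => Complex.exp (Complex.I * (x : ℂ)))
      = fun x : ℝ => Complex.I ^ n * Complex.exp (Complex.I * (x : ℂ)) := by
    intro n
    induction n with
    | zero => simp
    | succ n ih =>
      rw [iteratedDeriv_succ, ih]
      ext x
      have h1 : HasDerivAt (fun x : ℝ => Complex.I * (x : ℂ)) (Complex.I * 1) x :=
        (Complex.ofRealCLM.hasDerivAt (x := x)).const_mul Complex.I
      have h2 := (h1.cexp).const_mul (Complex.I ^ n)
      rw [h2.deriv]
      ring
  refine ⟨(contDiff_const.mul Complex.ofRealCLM.contDiff).cexp, fun n => ⟨0, 1, fun x => ?_⟩⟩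
  rw [norm_iteratedFDeriv_eq_norm_iteratedDeriv, hd]
  simp [mul_comm Complex.I (x : ℂ), Complex.norm_exp_ofReal_mul_I]

/-- Iterated integrals over `ℝ²` as integrals over `ℂ`. -/
lemma integral_integral_eq_integral_complex {h : ℂ → ℂ} (hh : Integrable h) :
    ∫ x : ℝ, ∫ y : ℝ, h ⟨x, y⟩ = ∫ z, h z := by
  have hmp := Complex.volume_preserving_equiv_real_prod.symm
  have h2 : Integrable (fun p : ℝ × ℝ => h ⟨p.1, p.2⟩) (volume.prod volume) :=
    (hmp.integrable_comp_emb (MeasurableEquiv.measurableEmbedding _)).2 hh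
  have h3 := integral_prod _ h2
  rw [← h3]
  exact hmp.integral_comp (MeasurableEquiv.measurableEmbedding _) h

lemma FT1_eq_fourier (f : ℝ → ℂ) (ξ : ℝ) : FT1 f ξ = 𝓕 f ((2 * π)⁻¹ * ξ) := by
  rw [FT1, Real.fourier_real_eq_integral_exp_smul]
  congr with x
  rw [smul_eq_mul]
  congr 2
  push_cast
  field_simp

lemma IFT1_eq_fourierInv (g : ℝ → ℂ) (x : ℝ) :
    IFT1 g x = (2 * (π : ℂ))⁻¹ * 𝓕⁻ g ((2 * π)⁻¹ * x) := by
  rw [IFT1, Real.fourierInv_eq']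
  congr 2 with ξ
  rw [smul_eq_mul]
  congr 2
  simp
  field_simp

lemma FT2_eq_fourier {f : ℝ → ℝ → ℂ} (hf : Integrable fun z : ℂ => f z.re z.im) (ξ η : ℝ) :
    FT2 f ξ η = 𝓕 (fun z : ℂ => f z.re z.im) ((2 * π)⁻¹ • (⟨ξ, η⟩ : ℂ)) := by
  rw [Real.fourier_eq', FT2, ← integral_integral_eq_integral_complex]
  · congr with x
    congr with y
    rw [smul_eq_mul]
    congr 2
    simp [Complex.inner]
    field_simp
  · refine (integrable_norm_iff ?_).1 ?_
    · refine AEStronglyMeasurable.smul (𝕜 := ℂ) ?_ hf.aestronglyMeasurable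
      apply Continuous.aestronglyMeasurable
      fun_prop
    · refine hf.norm.congr (Filter.Eventually.of_forall fun z => ?_)
      simp [Complex.norm_exp]

lemma IFT2_eq_fourierInv {g : ℝ → ℝ → ℂ} (hg : Integrable fun z : ℂ => g z.re z.im) (x y : ℝ) :
    IFT2 g x y = ((2 * (π : ℂ)) ^ 2)⁻¹ *
      𝓕⁻ (fun z : ℂ => g z.re z.im) ((2 * π)⁻¹ • (⟨x, y⟩ : ℂ)) := by
  rw [Real.fourierInv_eq', IFT2, ← integral_integral_eq_integral_complex]
  · congr 2 with x
    congr with y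
    rw [smul_eq_mul]
    congr 2
    simp [Complex.inner]
    field_simp
  · refine (integrable_norm_iff ?_).1 ?_
    · refine AEStronglyMeasurable.smul (𝕜 := ℂ) ?_ hg.aestronglyMeasurable
      apply Continuous.aestronglyMeasurable
      fun_prop
    · refine hg.norm.congr (Filter.Eventually.of_forall fun z => ?_)
      simp [Complex.norm_exp]

/-- The Fourier transform, in the convention of `FT2`, of a Schwartz function is Schwartz. -/
lemma exists_schwartz_eq_FT2 (Γ₀ : 𝓢(ℝ × ℝ, ℂ)) :
    ∃ g : 𝓢(ℂ, ℂ), ∀ ξ η, FT2 (fun a b => Γ₀ (a, b)) ξ η = g ⟨ξ, η⟩ := by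
  let Γ' : 𝓢(ℂ, ℂ) := compCLMOfContinuousLinearEquiv ℂ Complex.equivRealProdCLM Γ₀
  have hΓ' : ⇑Γ' = fun z : ℂ => Γ₀ (z.re, z.im) := rfl
  have hr : ((2 * π)⁻¹ : ℝ) ≠ 0 := by positivity
  refine ⟨compCLMOfContinuousLinearEquiv ℂ
    (ContinuousLinearEquiv.smulLeft (Units.mk0 ((2 * π)⁻¹ : ℝ) hr)) (𝓕 Γ'), fun ξ η => ?_⟩
  rw [FT2_eq_fourier (f := fun a b => Γ₀ (a, b)) (by rw [← hΓ']; exact Γ'.integrable), ← hΓ',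
    ← SchwartzMap.fourier_coe]
  rfl

lemma exists_schwartz_eq_FT1 (f : 𝓢(ℝ, ℂ)) : ∃ φ : 𝓢(ℝ, ℂ), ∀ k, FT1 f k = φ k := by
  have hr : ((2 * π)⁻¹ : ℝ) ≠ 0 := by positivity
  refine ⟨compCLMOfContinuousLinearEquiv ℂ
    (ContinuousLinearEquiv.smulLeft (Units.mk0 ((2 * π)⁻¹ : ℝ) hr)) (𝓕 f), fun k => ?_⟩
  rw [FT1_eq_fourier, ← SchwartzMap.fourier_coe]
  rfl

lemma FT1_IFT1 {R : ℝ → ℂ} (hc : Continuous R) (hR : Integrable R) (hI : Integrable (IFT1 R))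
    (k : ℝ) : FT1 (IFT1 R) k = R k := by
  have hr : ((2 * π)⁻¹ : ℝ) ≠ 0 := by positivity
  have e : IFT1 R = fun x => (2 * (π : ℂ))⁻¹ * 𝓕⁻ R ((2 * π)⁻¹ * x) :=
    funext (IFT1_eq_fourierInv R)
  have hI' : Integrable (𝓕⁻ R) := by
    rw [e] at hI
    have h1 := hI.const_mul (2 * (π : ℂ))
    have h2 : (fun x => 2 * (π : ℂ) * ((2 * (π : ℂ))⁻¹ * 𝓕⁻ R ((2 * π)⁻¹ * x))) =
        fun x => 𝓕⁻ R ((2 * π)⁻¹ * x) := by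
      ext x
      rw [← mul_assoc, mul_inv_cancel₀ (by simp [Real.pi_ne_zero]), one_mul]
    rw [h2] at h1
    exact (integrable_comp_mul_left_iff _ hr).1 h1
  have hF : Integrable (𝓕 R) := by
    have h := hI'.comp_neg
    simpa only [Real.fourierInv_eq_fourier_neg, neg_neg] using h
  rw [← congrFun (hc.fourier_fourierInv_eq hR hF) k, FT1, Real.fourier_real_eq_integral_exp_smul, e]
  have h3 := Measure.integral_comp_mul_left
    (fun v : ℝ => Complex.exp (↑(-2 * π * v * k) * Complex.I) • 𝓕⁻ R v) ((2 * π)⁻¹)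
  rw [inv_inv, abs_of_pos (by positivity)] at h3
  rw [eq_comm, ← eq_inv_smul_iff₀ (by positivity)] at h3
  rw [h3, ← integral_smul]
  congr with x
  simp only [smul_eq_mul, Complex.real_smul]
  push_cast
  rw [← mul_assoc, ← mul_assoc, mul_comm _ (2 * (π : ℂ))⁻¹]
  congr 3
  field_simp

end Transforms

section Collapse
open FourierTransform

/-- The Fourier transform of the density `x ↦ Γ(t,x,x)`, in terms of the Fourier transform `g` of
the data. -/
def collapsedSymbol (g : ℂ → ℂ) (t k : ℝ) : ℂ :=
  (2 * (π : ℂ))⁻¹ *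
    ∫ ξ : ℝ, Complex.exp (Complex.I * (t : ℂ) * (((k : ℂ) - ξ) ^ 2 - (ξ : ℂ) ^ 2)) * g ⟨ξ, k - ξ⟩

lemma norm_cexp_phase (t k ξ : ℝ) :
    ‖Complex.exp (Complex.I * (t : ℂ) * (((k : ℂ) - ξ) ^ 2 - (ξ : ℂ) ^ 2))‖ = 1 := by
  have : Complex.I * (t : ℂ) * (((k : ℂ) - ξ) ^ 2 - (ξ : ℂ) ^ 2)
      = ((t * ((k - ξ) ^ 2 - ξ ^ 2) : ℝ) : ℂ) * Complex.I := by
    push_cast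
    ring
  rw [this, Complex.norm_exp_ofReal_mul_I]

lemma exists_schwartz_shear (g : 𝓢(ℂ, ℂ)) :
    ∃ G : 𝓢(ℝ × ℝ, ℂ), ∀ ξ k : ℝ, G (ξ, k) = g ⟨ξ, k - ξ⟩ := by
  refine ⟨compCLMOfContinuousLinearEquiv ℂ
    (((ContinuousLinearEquiv.refl ℝ ℝ).skewProd (ContinuousLinearEquiv.refl ℝ ℝ)
      (-ContinuousLinearMap.id ℝ ℝ)).trans Complex.equivRealProdCLM.symm) g, fun ξ k => ?_⟩
  rw [sub_eq_add_neg]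
  rfl

lemma exists_norm_schwartz_shear_le (g : 𝓢(ℂ, ℂ)) :
    ∃ C : ℝ, ∀ ξ k : ℝ, ‖g ⟨ξ, k - ξ⟩‖ ≤ C * (1 + ξ ^ 2)⁻¹ := by
  obtain ⟨C₀, -, h0⟩ := g.decay 0 0
  obtain ⟨C₂, -, h2⟩ := g.decay 2 0
  refine ⟨C₀ + C₂, fun ξ k => ?_⟩
  have a0 := h0 ⟨ξ, k - ξ⟩
  have a2 := h2 ⟨ξ, k - ξ⟩
  simp only [pow_zero, one_mul, norm_iteratedFDeriv_zero] at a0 a2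
  have hn : ξ ^ 2 ≤ ‖(⟨ξ, k - ξ⟩ : ℂ)‖ ^ 2 := by
    rw [← Complex.normSq_eq_norm_sq, Complex.normSq_mk]
    nlinarith [sq_nonneg (k - ξ)]
  rw [← div_eq_mul_inv, le_div_iff₀ (by positivity)]
  nlinarith [norm_nonneg (g ⟨ξ, k - ξ⟩)]

lemma continuous_schwartz_shear (g : 𝓢(ℂ, ℂ)) :
    Continuous fun p : ℝ × ℝ => g ⟨p.1, p.2 - p.1⟩ := by
  obtain ⟨G, hG⟩ := exists_schwartz_shear g
  exact G.continuous.congr fun p => hG p.1 p.2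

lemma integrable_schwartz_shear (g : 𝓢(ℂ, ℂ)) :
    Integrable (fun p : ℝ × ℝ => g ⟨p.1, p.2 - p.1⟩) (volume.prod volume) := by
  obtain ⟨G, hG⟩ := exists_schwartz_shear g
  exact (G.integrable (μ := volume)).congr (Filter.Eventually.of_forall fun p => hG p.1 p.2)

lemma integrable_schwartz_slice (g : 𝓢(ℂ, ℂ)) (k : ℝ) :
    Integrable (fun ξ : ℝ => g ⟨ξ, k - ξ⟩) ∧ MemLp (fun ξ : ℝ => g ⟨ξ, k - ξ⟩) 2 := by
  obtain ⟨C, hC⟩ := exists_norm_schwartz_shear_le g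
  have hcont : Continuous fun ξ : ℝ => g ⟨ξ, k - ξ⟩ :=
    (continuous_schwartz_shear g).comp (continuous_id.prodMk continuous_const)
  have hint : Integrable (fun ξ : ℝ => g ⟨ξ, k - ξ⟩) :=
    Integrable.mono' (integrable_inv_one_add_sq.const_mul C) hcont.aestronglyMeasurable
      (Filter.Eventually.of_forall fun ξ => hC ξ k)
  refine ⟨hint, ?_⟩
  rw [memLp_two_iff_integrable_sq_norm hcont.aestronglyMeasurable]
  obtain ⟨C₀, -, h0⟩ := g.decay 0 0
  refine Integrable.mono' (hint.norm.const_mul C₀)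
    (hcont.norm.pow 2).aestronglyMeasurable (Filter.Eventually.of_forall fun ξ => ?_)
  rw [Real.norm_of_nonneg (by positivity), sq]
  gcongr
  simpa using h0 ⟨ξ, k - ξ⟩

lemma continuous_collapsedSymbol (g : 𝓢(ℂ, ℂ)) :
    Continuous fun p : ℝ × ℝ => collapsedSymbol g p.1 p.2 := by
  obtain ⟨C, hC⟩ := exists_norm_schwartz_shear_le g
  refine continuous_const.mul (continuous_of_dominated
    (F := fun (p : ℝ × ℝ) (ξ : ℝ) =>
      Complex.exp (Complex.I * (p.1 : ℂ) * (((p.2 : ℂ) - ξ) ^ 2 - (ξ : ℂ) ^ 2)) * g ⟨ξ, p.2 - ξ⟩)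
    (bound := fun ξ => C * (1 + ξ ^ 2)⁻¹) (fun p => ?_)
    (fun p => Filter.Eventually.of_forall fun ξ => ?_)
    (integrable_inv_one_add_sq.const_mul C) (Filter.Eventually.of_forall fun ξ => ?_))
  · have := (continuous_schwartz_shear g).comp (continuous_id.prodMk (continuous_const (y := p.2)))
    have h2 : Continuous fun ξ : ℝ => g ⟨ξ, p.2 - ξ⟩ := this
    exact Continuous.aestronglyMeasurable (Continuous.mul (by fun_prop) h2)
  · rw [norm_mul, norm_cexp_phase, one_mul]
    exact hC ξ p.2
  · have := (continuous_schwartz_shear g).comp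
      ((continuous_const (y := ξ)).prodMk (continuous_snd (X := ℝ) (Y := ℝ)))
    have h2 : Continuous fun p : ℝ × ℝ => g ⟨ξ, p.2 - ξ⟩ := this
    exact Continuous.mul (by fun_prop) h2

lemma integrable_phase_mul_schwartz_shear (g : 𝓢(ℂ, ℂ)) (t : ℝ) :
    Integrable (fun p : ℝ × ℝ =>
      Complex.exp (Complex.I * (t : ℂ) * (((p.2 : ℂ) - p.1) ^ 2 - (p.1 : ℂ) ^ 2)) *
        g ⟨p.1, p.2 - p.1⟩) (volume.prod volume) := by
  refine (integrable_schwartz_shear g).norm.mono' ?_ (Filter.Eventually.of_forall fun p => ?_)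
  · exact Continuous.aestronglyMeasurable
      (Continuous.mul (by fun_prop) (continuous_schwartz_shear g))
  · rw [norm_mul, norm_cexp_phase, one_mul]

lemma integrable_collapsedSymbol (g : 𝓢(ℂ, ℂ)) (t : ℝ) : Integrable (collapsedSymbol g t) :=
  (integrable_phase_mul_schwartz_shear g t).integral_prod_right.const_mul _

lemma IFT2_diag_eq_IFT1 (g : 𝓢(ℂ, ℂ)) (t a : ℝ) :
    IFT2 (fun ξ η => Complex.exp (Complex.I * (t : ℂ) * ((η : ℂ) ^ 2 - (ξ : ℂ) ^ 2)) * g ⟨ξ, η⟩)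
      a a = IFT1 (collapsedSymbol g t) a := by
  have hsub : ∀ ξ : ℝ, (∫ η : ℝ, Complex.exp (Complex.I * ((ξ : ℂ) * a + (η : ℂ) * a)) *
      (Complex.exp (Complex.I * (t : ℂ) * ((η : ℂ) ^ 2 - (ξ : ℂ) ^ 2)) * g ⟨ξ, η⟩)) =
      ∫ k : ℝ, Complex.exp (Complex.I * (k : ℂ) * a) *
        (Complex.exp (Complex.I * (t : ℂ) * (((k : ℂ) - ξ) ^ 2 - (ξ : ℂ) ^ 2)) *
          g ⟨ξ, k - ξ⟩) := by
    intro ξ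
    rw [← integral_sub_right_eq_self _ ξ]
    congr with k
    push_cast
    congr 2
    ring
  rw [IFT2, IFT1]
  simp_rw [hsub]
  rw [integral_integral_swap]
  · simp_rw [collapsedSymbol, integral_const_mul, mul_left_comm _ (2 * (π : ℂ))⁻¹,
      integral_const_mul]
    rw [← mul_assoc, sq, mul_inv]
  · refine (integrable_schwartz_shear g).norm.mono' ?_ (Filter.Eventually.of_forall fun p => ?_)
    · exact Continuous.aestronglyMeasurable (Continuous.mul (by fun_prop)
        (Continuous.mul (by fun_prop) (continuous_schwartz_shear g)))
    · have h1 : Complex.I * (p.2 : ℂ) * a = ((p.2 * a : ℝ) : ℂ) * Complex.I := by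
        push_cast
        ring
      rw [Function.uncurry, norm_mul, norm_mul, norm_cexp_phase, one_mul, h1,
        Complex.norm_exp_ofReal_mul_I, one_mul]

lemma exists_schwartz_eq_IFT2_diag (g : 𝓢(ℂ, ℂ)) (t : ℝ) :
    ∃ ρ : 𝓢(ℝ, ℂ), ∀ a : ℝ,
      IFT2 (fun ξ η => Complex.exp (Complex.I * (t : ℂ) * ((η : ℂ) ^ 2 - (ξ : ℂ) ^ 2)) * g ⟨ξ, η⟩)
        a a = ρ a := by
  have hM : Function.HasTemperateGrowth fun z : ℂ =>
      Complex.exp (Complex.I * ((t * (z.im ^ 2 - z.re ^ 2) : ℝ) : ℂ)) := by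
    have him : Function.HasTemperateGrowth fun z : ℂ => z.im := Complex.imCLM.hasTemperateGrowth
    have hre : Function.HasTemperateGrowth fun z : ℂ => z.re := Complex.reCLM.hasTemperateGrowth
    exact hasTemperateGrowth_cexp_I_mul.comp
      (f := fun z : ℂ => t * (z.im ^ 2 - z.re ^ 2))
      ((Function.HasTemperateGrowth.const t).mul ((him.pow 2).sub (hre.pow 2)))
  let L : ℝ →L[ℝ] ℂ := ContinuousLinearMap.toSpanSingleton ℝ ((2 * π)⁻¹ • (⟨1, 1⟩ : ℂ))
  have hL : ∀ a : ℝ, L a = (2 * π)⁻¹ • (⟨a, a⟩ : ℂ) := by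
    intro a
    simp only [L, ContinuousLinearMap.toSpanSingleton_apply]
    apply Complex.ext <;> simp [mul_comm]
  have hanti : AntilipschitzWith (2 * π).toNNReal L := by
    refine L.antilipschitz_of_bound fun a => ?_
    have hpi : (0 : ℝ) < 2 * π := by positivity
    rw [hL, norm_smul, Real.norm_of_nonneg (inv_pos.2 hpi).le, Real.coe_toNNReal _ hpi.le,
      ← mul_assoc, mul_inv_cancel₀ hpi.ne', one_mul]
    exact Complex.abs_re_le_norm (⟨a, a⟩ : ℂ)
  let h : 𝓢(ℂ, ℂ) := smulLeftCLM ℂ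
    (fun z : ℂ => Complex.exp (Complex.I * ((t * (z.im ^ 2 - z.re ^ 2) : ℝ) : ℂ))) g
  have hh : ⇑h = fun z : ℂ =>
      Complex.exp (Complex.I * (t : ℂ) * ((z.im : ℂ) ^ 2 - (z.re : ℂ) ^ 2)) * g ⟨z.re, z.im⟩ := by
    rw [smulLeftCLM_apply hM]
    ext z
    rw [smul_eq_mul]
    push_cast
    rw [mul_assoc]
  refine ⟨((2 * (π : ℂ)) ^ 2)⁻¹ • compCLMOfAntilipschitz ℂ L.hasTemperateGrowth hanti (𝓕⁻ h),
    fun a => ?_⟩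
  rw [IFT2_eq_fourierInv (g := fun ξ η =>
    Complex.exp (Complex.I * (t : ℂ) * ((η : ℂ) ^ 2 - (ξ : ℂ) ^ 2)) * g ⟨ξ, η⟩)
    (by rw [← hh]; exact h.integrable), ← hh, ← SchwartzMap.fourierInv_coe, ← hL]
  rfl

/-- The symbol of the density is Schwartz in frequency and is its Fourier transform. -/
lemma exists_schwartz_eq_collapsedSymbol (Γ₀ : 𝓢(ℝ × ℝ, ℂ)) {g : 𝓢(ℂ, ℂ)}
    (hg : ∀ ξ η, FT2 (fun a b => Γ₀ (a, b)) ξ η = g ⟨ξ, η⟩) (t : ℝ) :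
    ∃ φ : 𝓢(ℝ, ℂ), φ = collapsedSymbol g t ∧
      ∀ k, FT1 (fun a => freeGamma (fun a b => Γ₀ (a, b)) t a a) k = φ k := by
  obtain ⟨ρ, hρ⟩ := exists_schwartz_eq_IFT2_diag g t
  have e1 : (fun a => freeGamma (fun a b => Γ₀ (a, b)) t a a) = ρ := by
    ext a
    simp_rw [freeGamma, hg]
    exact hρ a
  have e2 : ⇑ρ = IFT1 (collapsedSymbol g t) := by
    ext a
    rw [← hρ, IFT2_diag_eq_IFT1]
  obtain ⟨φ, hφ⟩ := exists_schwartz_eq_FT1 ρ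
  refine ⟨φ, ?_, fun k => by rw [e1, hφ]⟩
  ext k
  rw [← hφ, e2]
  have hpair : Continuous fun k : ℝ => (t, k) := by fun_prop
  have hI : Integrable (IFT1 (collapsedSymbol g t)) := by
    rw [← e2]
    exact ρ.integrable
  exact FT1_IFT1 ((continuous_collapsedSymbol g).comp hpair) (integrable_collapsedSymbol g t) hI k

end Collapse

section Estimate
open FourierTransform

lemma exists_eLpNorm_IFT1_le : ∃ C : ℝ≥0∞, C ≠ ∞ ∧ ∀ h : ℝ → ℂ, Integrable h → MemLp h 2 →
    eLpNorm (IFT1 h) 2 volume ≤ C * eLpNorm h 2 volume := by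
  have hr : ((2 * π)⁻¹ : ℝ) ≠ 0 := by positivity
  refine ⟨(‖(2 * (π : ℂ))⁻¹‖ₑ ^ (2 : ℝ) *
    ENNReal.ofReal |((2 * π)⁻¹ ^ Module.finrank ℝ ℝ)⁻¹|) ^ (1 / 2 : ℝ), ?_, fun h h1 h2 => ?_⟩
  · exact ENNReal.rpow_ne_top_of_nonneg (by norm_num) (ENNReal.mul_ne_top
      (ENNReal.rpow_ne_top_of_nonneg (by norm_num) enorm_ne_top) ENNReal.ofReal_ne_top)
  · rw [← eLpNorm_two_fourierInv h1 h2, eLpNorm_two_rpow_two, eLpNorm_two_rpow_two,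
      ← ENNReal.mul_rpow_of_nonneg _ _ (by norm_num), mul_assoc,
      ← lintegral_comp_smul_of_ne_zero hr (fun v => ‖𝓕⁻ h v‖ₑ ^ (2 : ℝ)),
      ← lintegral_const_mul' _ _ (ENNReal.rpow_ne_top_of_nonneg (by norm_num) enorm_ne_top)]
    refine le_of_eq ?_
    congr 2 with x
    rw [IFT1_eq_fourierInv, enorm_mul, ENNReal.mul_rpow_of_nonneg _ _ (by norm_num), smul_eq_mul]

lemma exists_eLpNorm_le_L2K_IFT2 : ∃ C : ℝ≥0∞, C ≠ ∞ ∧ ∀ h : ℝ → ℝ → ℂ,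
    Integrable (fun z : ℂ => h z.re z.im) → MemLp (fun z : ℂ => h z.re z.im) 2 →
    eLpNorm (fun z : ℂ => h z.re z.im) 2 volume ≤ C * L2K (IFT2 h) := by
  have hr : ((2 * π)⁻¹ : ℝ) ≠ 0 := by positivity
  set A : ℝ≥0∞ := ‖((2 * (π : ℂ)) ^ 2)⁻¹‖ₑ ^ (2 : ℝ) *
    ENNReal.ofReal |((2 * π)⁻¹ ^ Module.finrank ℝ ℂ)⁻¹| with hA
  have hA0 : A ≠ 0 := by
    refine mul_ne_zero ?_ ?_
    · rw [Ne, ENNReal.rpow_eq_zero_iff_of_pos (by norm_num), enorm_eq_zero]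
      simp [Real.pi_ne_zero]
    · rw [Ne, ENNReal.ofReal_eq_zero, not_le]
      positivity
  have hAt : A ≠ ∞ := ENNReal.mul_ne_top
    (ENNReal.rpow_ne_top_of_nonneg (by norm_num) enorm_ne_top) ENNReal.ofReal_ne_top
  refine ⟨(A⁻¹) ^ (1 / 2 : ℝ), ENNReal.rpow_ne_top_of_nonneg (by norm_num)
    (ENNReal.inv_ne_top.2 hA0), fun h h1 h2 => ?_⟩
  have key : ∫⁻ p : ℝ × ℝ, ‖IFT2 h p.1 p.2‖ₑ ^ (2 : ℝ) =
      A * ∫⁻ z, ‖𝓕⁻ (fun z : ℂ => h z.re z.im) z‖ₑ ^ (2 : ℝ) := by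
    rw [hA, mul_assoc, ← lintegral_comp_smul_of_ne_zero hr
      (fun v => ‖𝓕⁻ (fun z : ℂ => h z.re z.im) v‖ₑ ^ (2 : ℝ)),
      ← lintegral_const_mul' _ _ (ENNReal.rpow_ne_top_of_nonneg (by norm_num) enorm_ne_top),
      ← Complex.volume_preserving_equiv_real_prod.lintegral_comp_emb
        (MeasurableEquiv.measurableEmbedding _)]
    congr with z
    rw [IFT2_eq_fourierInv h1, enorm_mul, ENNReal.mul_rpow_of_nonneg _ _ (by norm_num)]
    rfl
  rw [L2K, eLpNorm_two_rpow_two (fun p : ℝ × ℝ => IFT2 h p.1 p.2), key,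
    ← eLpNorm_two_fourierInv h1 h2, eLpNorm_two_rpow_two,
    ← ENNReal.mul_rpow_of_nonneg _ _ (by norm_num), ← mul_assoc, ENNReal.inv_mul_cancel hA0 hAt,
    one_mul]

lemma enorm_collapsedSymbol (g : ℂ → ℂ) (t k : ℝ) :
    ‖collapsedSymbol g t k‖ₑ =
      ‖(2 * (π : ℂ))⁻¹‖ₑ * ‖𝓕 (fun ξ : ℝ => g ⟨ξ, k - ξ⟩) (k / π * t)‖ₑ := by
  have hphase : (∫ ξ : ℝ, Complex.exp (Complex.I * (t : ℂ) * (((k : ℂ) - ξ) ^ 2 - (ξ : ℂ) ^ 2)) *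
      g ⟨ξ, k - ξ⟩) = Complex.exp (((t * k ^ 2 : ℝ) : ℂ) * Complex.I) *
        𝓕 (fun ξ : ℝ => g ⟨ξ, k - ξ⟩) (k / π * t) := by
    rw [Real.fourier_real_eq_integral_exp_smul, ← integral_const_mul]
    congr with ξ
    rw [smul_eq_mul, ← mul_assoc, ← Complex.exp_add]
    congr 2
    push_cast
    field_simp
    ring
  have h1 : ‖Complex.exp (((t * k ^ 2 : ℝ) : ℂ) * Complex.I)‖ₑ = 1 := by
    rw [← ofReal_norm, Complex.norm_exp_ofReal_mul_I, ENNReal.ofReal_one]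
  rw [collapsedSymbol, hphase, enorm_mul, enorm_mul, h1, one_mul]

lemma exists_lintegral_collapsedSymbol_rpow_le {q σ : ℝ} (hq : 2 ≤ q) (hσ : 1 / 2 - 1 / q < σ) :
    ∃ C : ℝ≥0∞, C ≠ ∞ ∧ ∀ (g : 𝓢(ℂ, ℂ)) (k : ℝ), k ≠ 0 →
      ENNReal.ofReal (|k| ^ (2 * (2 / q + σ - 1 / 2))) *
          (∫⁻ t, ‖collapsedSymbol g t k‖ₑ ^ q) ^ (2 / q) ≤
        C * ∫⁻ ξ : ℝ, ENNReal.ofReal ((ξ ^ 2 + (k - ξ) ^ 2) ^ σ) * ‖g ⟨ξ, k - ξ⟩‖ₑ ^ (2 : ℝ) := by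
  obtain ⟨C, hC, hmain⟩ := exists_lintegral_fourier_rpow_le hq hσ
  have hq0 : 0 < q := by linarith
  set A : ℝ≥0∞ := ‖(2 * (π : ℂ))⁻¹‖ₑ with hA
  have hAq : A ^ q ≠ ∞ := ENNReal.rpow_ne_top_of_nonneg hq0.le enorm_ne_top
  refine ⟨(A ^ q * ENNReal.ofReal π) ^ (2 / q) * C ^ (2 : ℝ), ?_, fun g k hk => ?_⟩
  · exact ENNReal.mul_ne_top (ENNReal.rpow_ne_top_of_nonneg (by positivity)
      (ENNReal.mul_ne_top hAq ENNReal.ofReal_ne_top))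
      (ENNReal.rpow_ne_top_of_nonneg (by norm_num) hC)
  have hk0 : 0 < |k| := abs_pos.2 hk
  have hr : k / π ≠ 0 := div_ne_zero hk Real.pi_ne_zero
  obtain ⟨hs1, hs2⟩ := integrable_schwartz_slice g k
  have hb := hmain (fun ξ : ℝ => g ⟨ξ, k - ξ⟩) (fun ξ => ξ ^ 2 + (k - ξ) ^ 2) |k| hk0 hs1 hs2
    (fun ξ => by rw [sq_abs]; nlinarith [sq_nonneg (k - 2 * ξ), sq_nonneg k])
    (fun ξ => by nlinarith [sq_nonneg (k - ξ)])
  set F : ℝ≥0∞ := ∫⁻ x, ‖𝓕 (fun ξ : ℝ => g ⟨ξ, k - ξ⟩) x‖ₑ ^ q with hF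
  set S : ℝ≥0∞ :=
    ∫⁻ ξ : ℝ, ENNReal.ofReal ((ξ ^ 2 + (k - ξ) ^ 2) ^ σ) * ‖g ⟨ξ, k - ξ⟩‖ₑ ^ (2 : ℝ) with hS
  have htime : ∫⁻ t, ‖collapsedSymbol g t k‖ₑ ^ q =
      A ^ q * ENNReal.ofReal π * ENNReal.ofReal (|k|⁻¹) * F := by
    have h1 := lintegral_comp_smul_of_ne_zero hr
      (fun v : ℝ => ‖𝓕 (fun ξ : ℝ => g ⟨ξ, k - ξ⟩) v‖ₑ ^ q)
    have h2 : |((k / π) ^ Module.finrank ℝ ℝ)⁻¹| = π * |k|⁻¹ := by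
      rw [Module.finrank_self, pow_one, inv_div, abs_div, abs_of_pos Real.pi_pos, div_eq_mul_inv]
    rw [h2, ENNReal.ofReal_mul Real.pi_pos.le] at h1
    simp_rw [enorm_collapsedSymbol, ENNReal.mul_rpow_of_nonneg _ _ hq0.le]
    rw [lintegral_const_mul' _ _ hAq, mul_assoc (A ^ q), mul_assoc (A ^ q), ← h1]
    rfl
  have hF2 : F ^ (2 / q) ≤ C ^ (2 : ℝ) * ENNReal.ofReal (|k| ^ (2 * (1 / 2 - 1 / q - σ))) * S := by
    have h1 := ENNReal.rpow_le_rpow hb (by norm_num : (0 : ℝ) ≤ 2)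
    rw [← ENNReal.rpow_mul, ENNReal.mul_rpow_of_nonneg _ _ (by norm_num),
      ENNReal.mul_rpow_of_nonneg _ _ (by norm_num), ← ENNReal.rpow_mul,
      ENNReal.ofReal_rpow_of_pos (Real.rpow_pos_of_pos hk0 _), ← Real.rpow_mul hk0.le] at h1
    convert h1 using 2
    · ring
    · congr 3
      ring
    · norm_num
  rw [htime, ENNReal.mul_rpow_of_nonneg _ _ (by positivity),
    ENNReal.mul_rpow_of_nonneg (A ^ q * ENNReal.ofReal π) _ (by positivity),
    ENNReal.ofReal_rpow_of_pos (by positivity), Real.inv_rpow hk0.le, ← Real.rpow_neg hk0.le]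
  have hpow : ENNReal.ofReal (|k| ^ (2 * (2 / q + σ - 1 / 2))) * ENNReal.ofReal (|k| ^ (-(2 / q))) *
      ENNReal.ofReal (|k| ^ (2 * (1 / 2 - 1 / q - σ))) = 1 := by
    rw [← ENNReal.ofReal_mul (by positivity), ← ENNReal.ofReal_mul (by positivity),
      ← Real.rpow_add hk0, ← Real.rpow_add hk0]
    have : 2 * (2 / q + σ - 1 / 2) + -(2 / q) + 2 * (1 / 2 - 1 / q - σ) = 0 := by ring
    rw [this, Real.rpow_zero, ENNReal.ofReal_one]
  calc _ ≤ ENNReal.ofReal (|k| ^ (2 * (2 / q + σ - 1 / 2))) *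
        ((A ^ q * ENNReal.ofReal π) ^ (2 / q) * ENNReal.ofReal (|k| ^ (-(2 / q))) *
          (C ^ (2 : ℝ) * ENNReal.ofReal (|k| ^ (2 * (1 / 2 - 1 / q - σ))) * S)) := by gcongr
    _ = (ENNReal.ofReal (|k| ^ (2 * (2 / q + σ - 1 / 2))) * ENNReal.ofReal (|k| ^ (-(2 / q))) *
          ENNReal.ofReal (|k| ^ (2 * (1 / 2 - 1 / q - σ)))) *
          ((A ^ q * ENNReal.ofReal π) ^ (2 / q) * C ^ (2 : ℝ) * S) := by ring
    _ = _ := by rw [hpow, one_mul]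

lemma lintegral_shear {H : ℂ → ℝ≥0∞} (hH : Measurable H) :
    ∫⁻ k : ℝ, ∫⁻ ξ : ℝ, H ⟨ξ, k - ξ⟩ = ∫⁻ z, H z := by
  have hm : Measurable fun p : ℝ × ℝ => (⟨p.1, p.2⟩ : ℂ) :=
    Complex.measurableEquivRealProd.symm.measurable
  have hm2 : Measurable (Function.uncurry fun k ξ : ℝ => H ⟨ξ, k - ξ⟩) := by
    have h1 : Measurable fun p : ℝ × ℝ => (p.2, p.1 - p.2) := by fun_prop
    exact hH.comp (hm.comp h1)
  rw [lintegral_lintegral_swap hm2.aemeasurable]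
  have hsub : ∀ ξ : ℝ, ∫⁻ k : ℝ, H ⟨ξ, k - ξ⟩ = ∫⁻ η : ℝ, H ⟨ξ, η⟩ := fun ξ =>
    lintegral_sub_right_eq_self (fun η : ℝ => H ⟨ξ, η⟩) ξ
  simp_rw [hsub]
  rw [← lintegral_prod (μ := volume) (ν := volume) (fun p : ℝ × ℝ => H ⟨p.1, p.2⟩)
      (hH.comp hm).aemeasurable,
    ← Complex.volume_preserving_equiv_real_prod.symm.lintegral_comp_emb
      (MeasurableEquiv.measurableEmbedding _)]
  rfl

end Estimate

section Main

/-- Minkowski's inequality in the form used for `L^q_t L²_x` norms, after Plancherel in `x`. -/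
lemma lintegral_rpow_lintegral_weight_le {q : ℝ} (hq : 2 ≤ q) {W : ℝ → ℝ≥0∞} (hW : Measurable W)
    (hWt : ∀ k, W k ≠ ∞) {R : ℝ → ℝ → ℂ} (hR : Measurable fun p : ℝ × ℝ => R p.1 p.2) :
    (∫⁻ t, ((∫⁻ k, W k * ‖R t k‖ₑ ^ (2 : ℝ)) ^ (1 / 2 : ℝ)) ^ q) ^ (1 / q) ≤
      (∫⁻ k, W k * (∫⁻ t, ‖R t k‖ₑ ^ q) ^ (2 / q)) ^ (1 / 2 : ℝ) := by
  have hq0 : 0 < q := by linarith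
  have hf : Measurable (Function.uncurry fun t k => W k * ‖R t k‖ₑ ^ (2 : ℝ)) :=
    (hW.comp measurable_snd).mul (hR.enorm.pow_const 2)
  have hmink := ENNReal.rpow_le_rpow
    (lintegral_rpow_lintegral_le (μ := volume) (ν := volume) (p := q / 2) (by linarith) hf)
    (by norm_num : (0 : ℝ) ≤ 1 / 2)
  have hinner : ∀ k, (∫⁻ t, (W k * ‖R t k‖ₑ ^ (2 : ℝ)) ^ (q / 2)) ^ (1 / (q / 2)) =
      W k * (∫⁻ t, ‖R t k‖ₑ ^ q) ^ (2 / q) := by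
    intro k
    have h1 : ∀ t, (W k * ‖R t k‖ₑ ^ (2 : ℝ)) ^ (q / 2) = W k ^ (q / 2) * ‖R t k‖ₑ ^ q := by
      intro t
      rw [ENNReal.mul_rpow_of_nonneg _ _ (by positivity), ← ENNReal.rpow_mul,
        mul_div_cancel₀ _ (by norm_num : (2 : ℝ) ≠ 0)]
    simp_rw [h1]
    rw [lintegral_const_mul' _ _ (ENNReal.rpow_ne_top_of_nonneg (by positivity) (hWt k)),
      ENNReal.mul_rpow_of_nonneg _ _ (by positivity), ← ENNReal.rpow_mul,
      mul_one_div_cancel (by positivity), ENNReal.rpow_one, one_div_div]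
  simp_rw [hinner] at hmink
  refine le_trans (le_of_eq ?_) hmink
  simp_rw [← ENNReal.rpow_mul]
  congr 1
  · congr with t
    congr 1
    ring
  · field_simp

lemma enorm_rpow_mul {c : ℝ} (hc : 0 ≤ c) (σ : ℝ) (w : ℂ) :
    ‖((c ^ σ : ℝ) : ℂ) * w‖ₑ ^ (2 : ℝ) = ENNReal.ofReal (c ^ (2 * σ)) * ‖w‖ₑ ^ (2 : ℝ) := by
  have hn : 0 ≤ c ^ σ := Real.rpow_nonneg hc σ
  rw [enorm_mul, ENNReal.mul_rpow_of_nonneg _ _ (by norm_num), ← ofReal_norm (_ : ℂ),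
    Complex.norm_real, Real.norm_of_nonneg hn, ENNReal.ofReal_rpow_of_nonneg hn (by norm_num),
    ← Real.rpow_mul hc, mul_comm σ]

end Main

/-- Collapsing estimate with `σ`-derivatives of the data, `σ = (3/2−ε)ε`,
`q = 2/((2−ε)(1/2−ε))`. -/
theorem collapsing_estimate_sigma (ε : ℝ) (hε0 : 0 < ε) (hε : ε < 1/2) :
    ∃ C : ℝ, 0 < C ∧ ∀ Γ₀ : 𝓢(ℝ × ℝ, ℂ),
      MixedN2 volume (ENNReal.ofReal (2 / ((2 - ε) * (1/2 - ε)))) 2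
          (fun t x => absDx (1/2 - ε) (fun a => freeGamma (fun a b => Γ₀ (a, b)) t a a) x)
        ≤ ENNReal.ofReal C * L2K (absDxy ((3/2 - ε) * ε) (fun a b => Γ₀ (a, b))) := by
  set q : ℝ := 2 / ((2 - ε) * (1/2 - ε)) with hqdef
  set σ : ℝ := (3/2 - ε) * ε with hσdef
  have hD : 0 < (2 - ε) * (1/2 - ε) := mul_pos (by linarith) (by linarith)
  have hq : 2 ≤ q := by
    rw [hqdef, le_div_iff₀ hD]
    nlinarith
  have hq0 : 0 < q := by linarith
  have h2q : 2 / q = (2 - ε) * (1/2 - ε) := by rw [hqdef]; field_simp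
  have h1q : 1 / q = (2 - ε) * (1/2 - ε) / 2 := by rw [← h2q]; ring
  have hs : 2 / q + σ - 1 / 2 = 1 / 2 - ε := by rw [h2q, hσdef]; ring
  have hσ : 1 / 2 - 1 / q < σ := by rw [h1q, hσdef]; nlinarith
  have hσ0 : 0 ≤ σ := mul_nonneg (by linarith) hε0.le
  have hσ1 : σ ≤ 1 := by rw [hσdef]; nlinarith
  obtain ⟨C₁, hC₁, hdens⟩ := exists_eLpNorm_IFT1_le
  obtain ⟨C₂, hC₂, hdata⟩ := exists_eLpNorm_le_L2K_IFT2
  obtain ⟨C₃, hC₃, hslice⟩ := exists_lintegral_collapsedSymbol_rpow_le hq hσ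
  rw [hs] at hslice
  have hK : C₁ * C₃ ^ (1 / 2 : ℝ) * C₂ ≠ ∞ := ENNReal.mul_ne_top
    (ENNReal.mul_ne_top hC₁ (ENNReal.rpow_ne_top_of_nonneg (by norm_num) hC₃)) hC₂
  refine ⟨(C₁ * C₃ ^ (1 / 2 : ℝ) * C₂).toReal + 1, by positivity, fun Γ₀ => ?_⟩
  obtain ⟨g, hg⟩ := exists_schwartz_eq_FT2 Γ₀
  set W : ℝ → ℝ≥0∞ := fun k => ENNReal.ofReal (|k| ^ (2 * (1 / 2 - ε))) with hWdef
  have hW : Measurable W := by fun_prop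
  have hR : Measurable fun p : ℝ × ℝ => collapsedSymbol g p.1 p.2 :=
    (continuous_collapsedSymbol g).measurable
  have hspace : ∀ t, eLpNorm (fun x => absDx (1/2 - ε)
      (fun a => freeGamma (fun a b => Γ₀ (a, b)) t a a) x) 2 volume ≤
      C₁ * (∫⁻ k, W k * ‖collapsedSymbol g t k‖ₑ ^ (2 : ℝ)) ^ (1 / 2 : ℝ) := by
    intro t
    obtain ⟨φ, hφ, hφ'⟩ := exists_schwartz_eq_collapsedSymbol Γ₀ hg t
    obtain ⟨hi, hi2⟩ := integrable_norm_rpow_mul_schwartz φ (s := 1 / 2 - ε) (by linarith)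
      (by linarith)
    have h1 := hdens _ hi hi2
    rw [eLpNorm_two_rpow_two (fun k : ℝ => ((‖k‖ ^ (1 / 2 - ε) : ℝ) : ℂ) * φ k)] at h1
    simp_rw [enorm_rpow_mul (norm_nonneg _), hφ] at h1
    simp_rw [absDx, hφ', hφ]
    exact h1
  have hmix : MixedN2 volume (ENNReal.ofReal q) 2
      (fun t x => absDx (1/2 - ε) (fun a => freeGamma (fun a b => Γ₀ (a, b)) t a a) x) ≤
      C₁ * (∫⁻ t, ((∫⁻ k, W k * ‖collapsedSymbol g t k‖ₑ ^ (2 : ℝ)) ^ (1 / 2 : ℝ)) ^ q) ^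
        (1 / q) := by
    rw [MixedN2, eLpNorm_eq_lintegral_rpow_enorm_toReal (by simpa using hq0) ENNReal.ofReal_ne_top,
      ENNReal.toReal_ofReal hq0.le]
    calc _ ≤ (∫⁻ t, (C₁ * (∫⁻ k, W k * ‖collapsedSymbol g t k‖ₑ ^ (2 : ℝ)) ^ (1 / 2 : ℝ)) ^ q) ^
          (1 / q) := by
          gcongr with t
          refine le_trans ?_ (hspace t)
          rw [Real.enorm_of_nonneg ENNReal.toReal_nonneg]
          exact ENNReal.ofReal_toReal_le
      _ = _ := by
          simp_rw [ENNReal.mul_rpow_of_nonneg C₁ _ hq0.le]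
          rw [lintegral_const_mul' _ _ (ENNReal.rpow_ne_top_of_nonneg hq0.le hC₁),
            ENNReal.mul_rpow_of_nonneg _ _ (by positivity), ← ENNReal.rpow_mul,
            mul_one_div_cancel hq0.ne', ENNReal.rpow_one]
  have hfreq : ∫⁻ k, W k * (∫⁻ t, ‖collapsedSymbol g t k‖ₑ ^ q) ^ (2 / q) ≤
      C₃ * ∫⁻ z : ℂ, ENNReal.ofReal (‖z‖ ^ (2 * σ)) * ‖g z‖ₑ ^ (2 : ℝ) := by
    have hH : Measurable fun z : ℂ => ENNReal.ofReal (‖z‖ ^ (2 * σ)) * ‖g z‖ₑ ^ (2 : ℝ) := by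
      have := g.continuous.measurable
      fun_prop
    rw [← lintegral_shear hH, ← lintegral_const_mul' _ _ hC₃]
    have hne : ∀ᵐ k : ℝ, k ≠ 0 := by simp [ae_iff]
    refine lintegral_mono_ae (hne.mono fun k hk => (hslice g k hk).trans (le_of_eq ?_))
    congr 2 with ξ
    rw [Real.rpow_mul (norm_nonneg _), Real.rpow_two, ← Complex.normSq_eq_norm_sq,
      Complex.normSq_mk, ← sq, ← sq]
  have hrhs : (∫⁻ z : ℂ, ENNReal.ofReal (‖z‖ ^ (2 * σ)) * ‖g z‖ₑ ^ (2 : ℝ)) ^ (1 / 2 : ℝ) ≤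
      C₂ * L2K (absDxy σ (fun a b => Γ₀ (a, b))) := by
    obtain ⟨hi, hi2⟩ := integrable_norm_rpow_mul_schwartz g hσ0 hσ1
    have he : (fun z : ℂ => (((z.re ^ 2 + z.im ^ 2) ^ (σ / 2) : ℝ) : ℂ) * g ⟨z.re, z.im⟩) =
        fun z => ((‖z‖ ^ σ : ℝ) : ℂ) * g z := by
      ext z
      have : z.re ^ 2 + z.im ^ 2 = ‖z‖ ^ (2 : ℝ) := by
        rw [Real.rpow_two, ← Complex.normSq_eq_norm_sq, Complex.normSq_apply, sq, sq]
      rw [this, ← Real.rpow_mul (norm_nonneg _), mul_div_cancel₀ _ (by norm_num : (2 : ℝ) ≠ 0)]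
    have h1 := hdata (fun ξ η => (((ξ ^ 2 + η ^ 2) ^ (σ / 2) : ℝ) : ℂ) * g ⟨ξ, η⟩)
      (by rw [he]; exact hi) (by rw [he]; exact hi2)
    rw [he, eLpNorm_two_rpow_two] at h1
    simp_rw [enorm_rpow_mul (norm_nonneg _)] at h1
    have h2 : absDxy σ (fun a b => Γ₀ (a, b)) =
        IFT2 (fun ξ η => (((ξ ^ 2 + η ^ 2) ^ (σ / 2) : ℝ) : ℂ) * g ⟨ξ, η⟩) := by
      ext x y
      simp_rw [absDxy, hg]
    rw [h2]
    exact h1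
  calc _ ≤ C₁ * (∫⁻ t,
        ((∫⁻ k, W k * ‖collapsedSymbol g t k‖ₑ ^ (2 : ℝ)) ^ (1 / 2 : ℝ)) ^ q) ^ (1 / q) := hmix
    _ ≤ C₁ * (∫⁻ k, W k * (∫⁻ t, ‖collapsedSymbol g t k‖ₑ ^ q) ^ (2 / q)) ^ (1 / 2 : ℝ) := by
        gcongr
        exact lintegral_rpow_lintegral_weight_le hq hW (fun k => ENNReal.ofReal_ne_top) hR
    _ ≤ C₁ * (C₃ * ∫⁻ z : ℂ, ENNReal.ofReal (‖z‖ ^ (2 * σ)) * ‖g z‖ₑ ^ (2 : ℝ)) ^ (1 / 2 : ℝ) := by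
        gcongr
    _ ≤ C₁ * (C₃ ^ (1 / 2 : ℝ) * (C₂ * L2K (absDxy σ (fun a b => Γ₀ (a, b))))) := by
        rw [ENNReal.mul_rpow_of_nonneg _ _ (by norm_num)]
        gcongr
    _ = C₁ * C₃ ^ (1 / 2 : ℝ) * C₂ * L2K (absDxy σ (fun a b => Γ₀ (a, b))) := by ring
    _ ≤ _ := by
        gcongr
        exact (ENNReal.le_ofReal_iff_toReal_le hK (by positivity)).2 (by linarith)

end
end

section
/- Non-endpoint Strichartz estimate for the free von-Neumann Schrödinger flow: let (k,ℓ) ∈ (2,∞]×[2,∞] satisfy 2/k + 1/ℓ = 1/2. Then there is a constant C = C(k,ℓ) such that for every Schwartz Γ₀ on ℝ², ‖ e^{it(Δ_x−Δ_y)} Γ₀ ‖_{L^k(ℝ_t) L^ℓ(dx) L²(dy)} ≤ C ‖Γ₀‖_{L²(ℝ²)}. -/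
open MeasureTheory Complex SchwartzMap
open scoped ENNReal NNReal Real

noncomputable section

/-- The phase `e^{i(xξ - tξ²)}` of the free Schrödinger flow. -/
def chirp (x t ξ : ℝ) : ℂ := Complex.exp (Complex.I * ((x : ℂ) * ξ - (t : ℂ) * (ξ : ℂ) ^ 2))

lemma norm_chirp (x t ξ : ℝ) : ‖chirp x t ξ‖ = 1 := by
  have : Complex.I * ((x : ℂ) * ξ - (t : ℂ) * (ξ : ℂ) ^ 2)
      = ((x * ξ - t * ξ ^ 2 : ℝ) : ℂ) * Complex.I := by push_cast; ring
  rw [chirp, this, Complex.norm_exp_ofReal_mul_I]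

lemma enorm_chirp (x t ξ : ℝ) : ‖chirp x t ξ‖ₑ = 1 := by
  rw [← ofReal_norm, norm_chirp, ENNReal.ofReal_one]

lemma measurable_chirp {α : Type*} [MeasurableSpace α] {a b c : α → ℝ} (ha : Measurable a)
    (hb : Measurable b) (hc : Measurable c) : Measurable fun z => chirp (a z) (b z) (c z) := by
  unfold chirp; fun_prop

lemma chirp_mul_conj_chirp (a b a' b' ξ : ℝ) :
    chirp a b ξ * (starRingEnd ℂ) (chirp a' b' ξ) = chirp (a - a') (b - b') ξ := by
  unfold chirp
  rw [← Complex.exp_conj, ← Complex.exp_add]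
  congr 1
  simp only [map_mul, map_sub, map_pow, Complex.conj_I, Complex.conj_ofReal]
  push_cast
  ring

/-- The Fourier transform of the complex Gaussian with parameter `ε + it`. -/
def gaussKernel (ε x t : ℝ) : ℂ :=
  ∫ ξ : ℝ, chirp x t ξ * ((Real.exp (-ε * ξ ^ 2) : ℝ) : ℂ)

lemma gaussKernel_eq {ε : ℝ} (hε : 0 < ε) (x t : ℝ) :
    gaussKernel ε x t = ((π : ℂ) / (ε + t * Complex.I)) ^ (1 / 2 : ℂ)
      * Complex.exp (-(x : ℂ) ^ 2 / (4 * (ε + t * Complex.I))) := by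
  rw [← fourierIntegral_gaussian (b := (ε : ℂ) + t * Complex.I) (by simpa using hε)]
  unfold gaussKernel chirp
  congr 1
  ext ξ
  rw [Complex.ofReal_exp, ← Complex.exp_add, ← Complex.exp_add]
  congr 1
  push_cast
  ring

lemma norm_gaussKernel_prefactor (z : ℂ) :
    ‖((π : ℂ) / z) ^ (1 / 2 : ℂ)‖ = (π / ‖z‖) ^ (1 / 2 : ℝ) := by
  have h : (1 / 2 : ℂ) = ((1 / 2 : ℝ) : ℂ) := by push_cast; rfl
  rw [h, Complex.norm_cpow_real, norm_div, Complex.norm_of_nonneg Real.pi_pos.le]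

/-- Dispersive estimate. -/
lemma norm_gaussKernel_le {ε : ℝ} (hε : 0 < ε) (x : ℝ) {t : ℝ} (ht : t ≠ 0) :
    ‖gaussKernel ε x t‖ ≤ π ^ (1 / 2 : ℝ) * |t| ^ (-(1 / 2) : ℝ) := by
  have hz : |t| ≤ ‖(ε : ℂ) + t * Complex.I‖ := by
    simpa using Complex.abs_im_le_norm ((ε : ℂ) + t * Complex.I)
  have ht' : 0 < |t| := abs_pos.mpr ht
  rw [gaussKernel_eq hε, norm_mul, norm_gaussKernel_prefactor, Complex.norm_exp]
  have hre : (-(x : ℂ) ^ 2 / (4 * (ε + t * Complex.I))).re ≤ 0 := by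
    have : (-(x : ℂ) ^ 2 / (4 * (ε + t * Complex.I)))
        = ((-x ^ 2 / 4 : ℝ) : ℂ) * ((ε : ℂ) + t * Complex.I)⁻¹ := by
      rw [div_eq_mul_inv, mul_inv]; push_cast; ring
    rw [this, Complex.re_ofReal_mul, Complex.inv_re]
    have h1 : ((ε : ℂ) + t * Complex.I).re = ε := by simp
    rw [h1]
    have := div_nonneg hε.le (Complex.normSq_nonneg ((ε : ℂ) + t * Complex.I))
    nlinarith [sq_nonneg x]
  calc _ ≤ (π / |t|) ^ (1 / 2 : ℝ) * 1 := by
        gcongr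
        exact Real.exp_le_one_iff.mpr hre
    _ = _ := by
        rw [mul_one, Real.div_rpow Real.pi_pos.le ht'.le, Real.rpow_neg ht'.le, div_eq_mul_inv]

lemma norm_gaussKernel_zero {ε : ℝ} (hε : 0 < ε) (x : ℝ) :
    ‖gaussKernel ε x 0‖ = (π / ε) ^ (1 / 2 : ℝ) * Real.exp (-(1 / (4 * ε)) * x ^ 2) := by
  rw [gaussKernel_eq hε, norm_mul, norm_gaussKernel_prefactor, Complex.norm_exp]
  have : (-(x : ℂ) ^ 2 / (4 * (ε + (0 : ℝ) * Complex.I)))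
      = ((-(1 / (4 * ε)) * x ^ 2 : ℝ) : ℂ) := by
    push_cast
    have : (ε : ℂ) ≠ 0 := by exact_mod_cast hε.ne'
    simp only [zero_mul, add_zero]
    field_simp
  rw [this, Complex.ofReal_re]
  simp [abs_of_pos hε]

lemma lintegral_gaussKernel_zero {ε : ℝ} (hε : 0 < ε) :
    ∫⁻ x, ‖gaussKernel ε x 0‖ₑ = ENNReal.ofReal (2 * π) := by
  have hb : 0 < 1 / (4 * ε) := by positivity
  simp_rw [← ofReal_norm, norm_gaussKernel_zero hε]
  rw [← ofReal_integral_eq_lintegral_ofReal ((integrable_exp_neg_mul_sq hb).const_mul _)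
    (Filter.Eventually.of_forall fun x => by positivity), integral_const_mul, integral_gaussian]
  congr 1
  rw [← Real.sqrt_eq_rpow, ← Real.sqrt_mul (by positivity)]
  have : π / ε * (π / (1 / (4 * ε))) = (2 * π) ^ 2 := by field_simp; ring
  rw [this, Real.sqrt_sq (by positivity)]

/-- The function `ξ ↦ ∫ w(z) e^{i(a(z)ξ - b(z)ξ²)} dμ(z)`. -/
def chirpTransform {α : Type*} [MeasurableSpace α] (μ : Measure α) (w : α → ℂ) (a b : α → ℝ)
    (ξ : ℝ) : ℂ := ∫ z, w z * chirp (a z) (b z) ξ ∂μ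

section ChirpTransform

variable {α : Type*} [MeasurableSpace α] {μ : Measure α} {w : α → ℂ} {a b : α → ℝ}

lemma norm_chirpTransform_le (ξ : ℝ) : ‖chirpTransform μ w a b ξ‖ ≤ ∫ z, ‖w z‖ ∂μ := by
  refine (norm_integral_le_integral_norm _).trans_eq ?_
  simp [norm_chirp]

lemma aestronglyMeasurable_mul_chirp (hw : Integrable w μ) (ha : Measurable a)
    (hb : Measurable b) : AEStronglyMeasurable
      (fun p : ℝ × α => w p.2 * chirp (a p.2) (b p.2) p.1) ((volume : Measure ℝ).prod μ) :=
  hw.aestronglyMeasurable.comp_snd.mul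
    (measurable_chirp (ha.comp measurable_snd) (hb.comp measurable_snd)
      measurable_fst).aestronglyMeasurable

lemma aestronglyMeasurable_chirpTransform [SFinite μ] (hw : Integrable w μ) (ha : Measurable a)
    (hb : Measurable b) : AEStronglyMeasurable (chirpTransform μ w a b) volume :=
  (aestronglyMeasurable_mul_chirp hw ha hb).integral_prod_right'

lemma chirpTransform_mul_conj [SFinite μ] (ξ : ℝ) :
    chirpTransform μ w a b ξ * (starRingEnd ℂ) (chirpTransform μ w a b ξ)
      = ∫ p : α × α, w p.1 * (starRingEnd ℂ) (w p.2)
          * chirp (a p.1 - a p.2) (b p.1 - b p.2) ξ ∂(μ.prod μ) := by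
  unfold chirpTransform
  rw [← integral_conj, ← integral_prod_mul]
  congr 1
  ext p
  rw [← chirp_mul_conj_chirp, map_mul]
  ring

lemma lintegral_sq_chirpTransform_mul_gaussian_le [SFinite μ] (hw : Integrable w μ) (ha : Measurable a)
    (hb : Measurable b) {ε : ℝ} (hε : 0 < ε) :
    ∫⁻ ξ, ‖chirpTransform μ w a b ξ‖ₑ ^ 2 * ENNReal.ofReal (Real.exp (-ε * ξ ^ 2))
      ≤ ∫⁻ p : α × α, ‖w p.1‖ₑ * ‖w p.2‖ₑ
          * ‖gaussKernel ε (a p.1 - a p.2) (b p.1 - b p.2)‖ₑ ∂(μ.prod μ) := by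
  have hG := integrable_exp_neg_mul_sq hε
  have hM := aestronglyMeasurable_chirpTransform hw ha hb
  have hInt : Integrable
      (fun ξ => ‖chirpTransform μ w a b ξ‖ ^ 2 * Real.exp (-ε * ξ ^ 2)) := by
    refine hG.bdd_mul (c := (∫ z, ‖w z‖ ∂μ) ^ 2) (hM.norm.pow 2)
      (Filter.Eventually.of_forall fun ξ => ?_)
    rw [norm_pow, norm_norm]
    gcongr
    exact norm_chirpTransform_le ξ
  have h1 : ∫⁻ ξ, ‖chirpTransform μ w a b ξ‖ₑ ^ 2 * ENNReal.ofReal (Real.exp (-ε * ξ ^ 2))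
      = ENNReal.ofReal (∫ ξ, ‖chirpTransform μ w a b ξ‖ ^ 2 * Real.exp (-ε * ξ ^ 2)) := by
    rw [ofReal_integral_eq_lintegral_ofReal hInt (Filter.Eventually.of_forall fun x => by
      positivity)]
    congr 1
    ext ξ
    rw [ENNReal.ofReal_mul (by positivity), ENNReal.ofReal_pow (by positivity),
      ofReal_norm]
  have h2 : ((∫ ξ, ‖chirpTransform μ w a b ξ‖ ^ 2 * Real.exp (-ε * ξ ^ 2) : ℝ) : ℂ)
      = ∫ p : α × α, w p.1 * (starRingEnd ℂ) (w p.2)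
          * gaussKernel ε (a p.1 - a p.2) (b p.1 - b p.2) ∂(μ.prod μ) := by
    rw [← integral_complex_ofReal]
    have : ∀ ξ : ℝ, ((‖chirpTransform μ w a b ξ‖ ^ 2 * Real.exp (-ε * ξ ^ 2) : ℝ) : ℂ)
        = ∫ p : α × α, w p.1 * (starRingEnd ℂ) (w p.2)
          * chirp (a p.1 - a p.2) (b p.1 - b p.2) ξ * ((Real.exp (-ε * ξ ^ 2) : ℝ) : ℂ)
            ∂(μ.prod μ) := by
      intro ξ
      rw [integral_mul_const, ← chirpTransform_mul_conj, Complex.mul_conj,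
        Complex.normSq_eq_norm_sq]
      push_cast
      rfl
    simp_rw [this]
    rw [integral_integral_swap]
    · congr 1
      ext p
      rw [gaussKernel, ← integral_const_mul]
      congr 1
      ext ξ
      ring
    · have hww : Integrable (fun p : α × α => w p.1 * (starRingEnd ℂ) (w p.2)) (μ.prod μ) :=
        hw.mul_prod (Complex.conjLIE.toContinuousLinearEquiv.toContinuousLinearMap.integrable_comp
          hw)
      have hmain : Integrable (fun q : ℝ × (α × α) => ((Real.exp (-ε * q.1 ^ 2) : ℝ) : ℂ)
          * (w q.2.1 * (starRingEnd ℂ) (w q.2.2))) ((volume : Measure ℝ).prod (μ.prod μ)) :=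
        hG.ofReal.mul_prod hww
      have hch : Measurable fun q : ℝ × (α × α) =>
          chirp (a q.2.1 - a q.2.2) (b q.2.1 - b q.2.2) q.1 :=
        measurable_chirp (by fun_prop) (by fun_prop) (by fun_prop)
      refine (hmain.bdd_mul (c := 1) hch.aestronglyMeasurable
        (Filter.Eventually.of_forall fun q => (norm_chirp _ _ _).le)).congr
        (Filter.Eventually.of_forall fun q => ?_)
      simp only [Function.uncurry]
      ring
  rw [h1]
  calc _ = ‖((∫ ξ, ‖chirpTransform μ w a b ξ‖ ^ 2 * Real.exp (-ε * ξ ^ 2) : ℝ) : ℂ)‖ₑ := by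
        rw [← ofReal_norm, Complex.norm_of_nonneg]
        exact integral_nonneg fun ξ => by positivity
    _ ≤ _ := by
        rw [h2]
        refine (enorm_integral_le_lintegral_enorm _).trans_eq ?_
        congr 1
        ext p
        rw [enorm_mul, enorm_mul]
        congr 2
        exact congrArg ENNReal.ofNNReal (RCLike.nnnorm_conj _)

end ChirpTransform

lemma lintegral_le_of_forall_mul_gaussian_le {F : ℝ → ℝ≥0∞} (hF : AEMeasurable F volume)
    {B : ℝ≥0∞} (h : ∀ ε : ℝ, 0 < ε →
      ∫⁻ ξ, F ξ * ENNReal.ofReal (Real.exp (-ε * ξ ^ 2)) ≤ B) : ∫⁻ ξ, F ξ ≤ B := by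
  have hlim : ∀ ξ, Filter.liminf (fun n : ℕ => F ξ * ENNReal.ofReal
      (Real.exp (-(1 / ((n : ℝ) + 1)) * ξ ^ 2))) Filter.atTop = F ξ := by
    intro ξ
    apply Filter.Tendsto.liminf_eq
    have h1 : Filter.Tendsto (fun n : ℕ => Real.exp (-(1 / ((n : ℝ) + 1)) * ξ ^ 2))
        Filter.atTop (nhds 1) := by
      have h0 := (tendsto_one_div_add_atTop_nhds_zero_nat (𝕜 := ℝ)).neg.mul_const (ξ ^ 2)
      simpa [Function.comp_def] using (Real.continuous_exp.tendsto _).comp h0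
    have h2 := ENNReal.Tendsto.const_mul (a := F ξ) (ENNReal.tendsto_ofReal h1) (Or.inl (by simp))
    simpa using h2
  calc ∫⁻ ξ, F ξ = ∫⁻ ξ, Filter.liminf (fun n : ℕ => F ξ * ENNReal.ofReal
      (Real.exp (-(1 / ((n : ℝ) + 1)) * ξ ^ 2))) Filter.atTop := by simp_rw [hlim]
    _ ≤ Filter.liminf (fun n : ℕ => ∫⁻ ξ, F ξ * ENNReal.ofReal
      (Real.exp (-(1 / ((n : ℝ) + 1)) * ξ ^ 2))) Filter.atTop :=
        lintegral_liminf_le' fun n => hF.mul (by fun_prop)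
    _ ≤ Filter.liminf (fun _ : ℕ => B) Filter.atTop := by
        refine Filter.liminf_le_liminf (Filter.Eventually.of_forall fun n => h _ (by positivity))
    _ = B := by simp

lemma measurable_enorm_gaussKernel_zero {ε : ℝ} (hε : 0 < ε) :
    Measurable fun x => ‖gaussKernel ε x 0‖ₑ := by
  simp_rw [← ofReal_norm, norm_gaussKernel_zero hε]
  fun_prop

/-- Bessel's inequality for the Fourier transform on `L¹ ∩ L²`. -/
lemma lintegral_sq_fourier_le {w : ℝ → ℂ} (hw : Integrable w) :
    ∫⁻ y, ‖∫ η : ℝ, w η * chirp η 0 y‖ₑ ^ 2 ≤ ENNReal.ofReal (2 * π) * ∫⁻ η, ‖w η‖ₑ ^ 2 := by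
  have hG := aestronglyMeasurable_chirpTransform (b := fun _ => 0) hw measurable_id
    measurable_const
  have hwm : AEMeasurable (fun p : ℝ => ‖w p‖ₑ) volume := hw.aestronglyMeasurable.enorm
  refine lintegral_le_of_forall_mul_gaussian_le (hG.enorm.pow_const 2) fun ε hε => ?_
  refine (lintegral_sq_chirpTransform_mul_gaussian_le (b := fun _ => 0) hw measurable_id
    measurable_const hε).trans ?_
  simp only [id, sub_self]
  have hk := measurable_enorm_gaussKernel_zero hε
  have hkm : Measurable fun p : ℝ × ℝ => ‖gaussKernel ε (p.1 - p.2) 0‖ₑ :=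
    hk.comp (measurable_fst.sub measurable_snd)
  have hw1 : AEMeasurable (fun p : ℝ × ℝ => ‖w p.1‖ₑ ^ 2 * ‖gaussKernel ε (p.1 - p.2) 0‖ₑ)
      (volume.prod volume) :=
    ((hwm.comp_quasiMeasurePreserving Measure.quasiMeasurePreserving_fst).pow_const 2).mul
      hkm.aemeasurable
  have hw2 : AEMeasurable (fun p : ℝ × ℝ => ‖w p.2‖ₑ ^ 2 * ‖gaussKernel ε (p.1 - p.2) 0‖ₑ)
      (volume.prod volume) :=
    ((hwm.comp_quasiMeasurePreserving Measure.quasiMeasurePreserving_snd).pow_const 2).mul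
      hkm.aemeasurable
  have e1 : ∫⁻ p : ℝ × ℝ, ‖w p.1‖ₑ ^ 2 * ‖gaussKernel ε (p.1 - p.2) 0‖ₑ ∂(volume.prod volume)
      = ENNReal.ofReal (2 * π) * ∫⁻ η, ‖w η‖ₑ ^ 2 := by
    rw [lintegral_prod _ hw1, ← lintegral_const_mul'' _ (hwm.pow_const 2)]
    congr 1
    ext x
    simp only
    rw [lintegral_const_mul' _ _ (by finiteness),
      lintegral_sub_left_eq_self (fun z => ‖gaussKernel ε z 0‖ₑ) x,
      lintegral_gaussKernel_zero hε, mul_comm]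
  have e2 : ∫⁻ p : ℝ × ℝ, ‖w p.2‖ₑ ^ 2 * ‖gaussKernel ε (p.1 - p.2) 0‖ₑ ∂(volume.prod volume)
      = ENNReal.ofReal (2 * π) * ∫⁻ η, ‖w η‖ₑ ^ 2 := by
    rw [lintegral_prod_symm _ hw2, ← lintegral_const_mul'' _ (hwm.pow_const 2)]
    congr 1
    ext x
    simp only
    rw [lintegral_const_mul' _ _ (by finiteness),
      lintegral_sub_right_eq_self (fun z => ‖gaussKernel ε z 0‖ₑ) x,
      lintegral_gaussKernel_zero hε, mul_comm]
  have hyoung : ∀ x y : ℝ≥0∞, 2 * (x * y) ≤ x ^ 2 + y ^ 2 := by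
    intro x y
    rcases le_total x y with h | h
    · obtain ⟨d, rfl⟩ := exists_add_of_le h
      calc 2 * (x * (x + d)) ≤ 2 * (x * (x + d)) + d ^ 2 := le_self_add
        _ = _ := by ring
    · obtain ⟨d, rfl⟩ := exists_add_of_le h
      calc 2 * ((y + d) * y) ≤ 2 * ((y + d) * y) + d ^ 2 := le_self_add
        _ = _ := by ring
  have h2 : (2 : ℝ≥0∞) * ∫⁻ p : ℝ × ℝ, ‖w p.1‖ₑ * ‖w p.2‖ₑ * ‖gaussKernel ε (p.1 - p.2) 0‖ₑ
        ∂(volume.prod volume) ≤ 2 * (ENNReal.ofReal (2 * π) * ∫⁻ η, ‖w η‖ₑ ^ 2) := by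
    calc _ = ∫⁻ p : ℝ × ℝ, 2 * (‖w p.1‖ₑ * ‖w p.2‖ₑ * ‖gaussKernel ε (p.1 - p.2) 0‖ₑ)
        ∂(volume.prod volume) := (lintegral_const_mul' _ _ (by simp)).symm
      _ ≤ ∫⁻ p : ℝ × ℝ, (‖w p.1‖ₑ ^ 2 * ‖gaussKernel ε (p.1 - p.2) 0‖ₑ
          + ‖w p.2‖ₑ ^ 2 * ‖gaussKernel ε (p.1 - p.2) 0‖ₑ) ∂(volume.prod volume) := by
          refine lintegral_mono fun p => ?_
          rw [← add_mul, ← mul_assoc]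
          gcongr
          exact hyoung _ _
      _ = _ := by rw [lintegral_add_left' hw1, e1, e2, ← two_mul]
  exact (ENNReal.mul_le_mul_iff_right (by simp) (by simp)).mp h2

lemma lintegral_comp_abs (F : ℝ → ℝ≥0∞) :
    ∫⁻ r, F |r| = 2 * ∫⁻ r in Set.Ioi 0, F r := by
  have hpos : ∫⁻ r in Set.Ioi (0 : ℝ), F |r| = ∫⁻ r in Set.Ioi 0, F r :=
    setLIntegral_congr_fun measurableSet_Ioi fun r hr => by
      simp only [abs_of_pos (Set.mem_Ioi.mp hr)]
  have hneg : ∫⁻ r in Set.Iic (0 : ℝ), F |r| = ∫⁻ r in Set.Ioi 0, F r := by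
    rw [← hpos, setLIntegral_congr Iio_ae_eq_Iic.symm]
    have := (Measure.measurePreserving_neg (volume : Measure ℝ)).setLIntegral_comp_preimage_emb
      (MeasurableEquiv.neg ℝ).measurableEmbedding (fun r => F |r|) (Set.Ioi 0)
    simpa using this
  rw [← lintegral_add_compl _ (measurableSet_Iic (a := (0 : ℝ))), Set.compl_Iic, hneg, hpos,
    two_mul]

lemma lintegral_near_rpow {R : ℝ} (hR : 0 < R) :
    ∫⁻ r, (Set.Iic R).indicator (fun r => ENNReal.ofReal r ^ (-(1 / 2) : ℝ)) |r|
      = ENNReal.ofReal (4 * R ^ (1 / 2 : ℝ)) := by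
  rw [lintegral_comp_abs, lintegral_indicator measurableSet_Iic,
    Measure.restrict_restrict measurableSet_Iic, Set.inter_comm, Set.Ioi_inter_Iic]
  have h1 : ∫⁻ r in Set.Ioc 0 R, ENNReal.ofReal r ^ (-(1 / 2) : ℝ)
      = ∫⁻ r in Set.Ioc 0 R, ENNReal.ofReal (r ^ (-(1 / 2) : ℝ)) :=
    setLIntegral_congr_fun measurableSet_Ioc fun r hr => by
      simp only [ENNReal.ofReal_rpow_of_pos hr.1]
  have hInt : IntegrableOn (fun r : ℝ => r ^ (-(1 / 2) : ℝ)) (Set.Ioc 0 R) :=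
    (intervalIntegrable_iff_integrableOn_Ioc_of_le hR.le).mp
      (intervalIntegral.intervalIntegrable_rpow' (by norm_num))
  rw [h1, ← ofReal_integral_eq_lintegral_ofReal hInt
    ((ae_restrict_iff' measurableSet_Ioc).mpr (Filter.Eventually.of_forall fun r hr =>
      Real.rpow_nonneg hr.1.le _)), ← intervalIntegral.integral_of_le hR.le,
    integral_rpow (Or.inl (by norm_num)), show (2 : ℝ≥0∞) = ENNReal.ofReal 2 by simp,
    ← ENNReal.ofReal_mul (by norm_num)]
  congr 1
  norm_num
  ring

lemma lintegral_far_rpow {R : ℝ} (hR : 0 < R) :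
    ∫⁻ r, (Set.Ioi R).indicator (fun r => ENNReal.ofReal r ^ (-2 : ℝ)) |r|
      = ENNReal.ofReal (2 / R) := by
  rw [lintegral_comp_abs, lintegral_indicator measurableSet_Ioi,
    Measure.restrict_restrict measurableSet_Ioi, Set.Ioi_inter_Ioi, sup_of_le_left hR.le]
  have h1 : ∫⁻ r in Set.Ioi R, ENNReal.ofReal r ^ (-2 : ℝ)
      = ∫⁻ r in Set.Ioi R, ENNReal.ofReal (r ^ (-2 : ℝ)) :=
    setLIntegral_congr_fun measurableSet_Ioi fun r hr => by
      simp only [ENNReal.ofReal_rpow_of_pos (hR.trans hr)]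
  rw [h1, ← ofReal_integral_eq_lintegral_ofReal (integrableOn_Ioi_rpow_of_lt (by norm_num) hR)
    ((ae_restrict_iff' measurableSet_Ioi).mpr (Filter.Eventually.of_forall fun r hr =>
      Real.rpow_nonneg (hR.trans hr).le _)), integral_Ioi_rpow_of_lt (by norm_num) hR,
    show (2 : ℝ≥0∞) = ENNReal.ofReal 2 by simp, ← ENNReal.ofReal_mul (by norm_num)]
  congr 1
  norm_num
  rw [Real.rpow_neg_one]
  ring

/-- The kernel `|r|^{-1/2}` of fractional integration of order one half. -/
def halfKernel (r : ℝ) : ℝ≥0∞ := ENNReal.ofReal |r| ^ (-(1 / 2) : ℝ)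

lemma measurable_halfKernel : Measurable halfKernel := by unfold halfKernel; fun_prop

lemma lintegral_min_mul_halfKernel_le {h : ℝ → ℝ≥0∞} (hh : Measurable h) {p q : ℝ} (hp : 0 < p)
    (hq : 0 < q) (hN : ∫⁻ s, h s ^ (4 / 3 : ℝ) = ENNReal.ofReal (p ^ 4)) (t : ℝ) :
    ∫⁻ s, min (h s) (ENNReal.ofReal (q ^ 3)) * halfKernel (t - s)
      ≤ ENNReal.ofReal (6 * p ^ 2 * q) := by
  set R : ℝ := (p / q) ^ 4 with hR
  have hRpos : 0 < R := by positivity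
  set near : ℝ → ℝ≥0∞ := fun r =>
    (Set.Iic R).indicator (fun r => ENNReal.ofReal r ^ (-(1 / 2) : ℝ)) |r| with hnear
  set far : ℝ → ℝ≥0∞ := fun r =>
    (Set.Ioi R).indicator (fun r => ENNReal.ofReal r ^ (-(1 / 2) : ℝ)) |r| with hfar
  have mnear : Measurable near :=
    (Measurable.indicator (by fun_prop) measurableSet_Iic).comp (by fun_prop)
  have mfar : Measurable far :=
    (Measurable.indicator (by fun_prop) measurableSet_Ioi).comp (by fun_prop)
  have hpt : ∀ s, min (h s) (ENNReal.ofReal (q ^ 3)) * halfKernel (t - s)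
      ≤ ENNReal.ofReal (q ^ 3) * near (t - s) + h s * far (t - s) := by
    intro s
    by_cases hs : |t - s| ≤ R
    · have : near (t - s) = halfKernel (t - s) := Set.indicator_of_mem (Set.mem_Iic.mpr hs) _
      rw [this]
      exact le_add_right (by gcongr; exact min_le_right _ _)
    · have : far (t - s) = halfKernel (t - s) :=
        Set.indicator_of_mem (Set.mem_Ioi.mpr (not_le.mp hs)) _
      rw [this]
      exact le_add_left (by gcongr; exact min_le_left _ _)
  have hfar4 : ∀ r, far r ^ (4 : ℝ)
      = (Set.Ioi R).indicator (fun r => ENNReal.ofReal r ^ (-2 : ℝ)) |r| := by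
    intro r
    by_cases hr : |r| ∈ Set.Ioi R
    · rw [hfar]
      simp only [Set.indicator_of_mem hr]
      rw [← ENNReal.rpow_mul]
      norm_num
    · rw [hfar]
      simp only [Set.indicator_of_notMem hr]
      norm_num
  have hnearI : ∫⁻ s, near (t - s) = ENNReal.ofReal (4 * (p / q) ^ 2) := by
    rw [lintegral_sub_left_eq_self near t, lintegral_near_rpow hRpos, ← Real.sqrt_eq_rpow, hR,
      show (p / q) ^ 4 = ((p / q) ^ 2) ^ 2 by ring, Real.sqrt_sq (by positivity)]
  have hfarI : ∫⁻ s, far (t - s) ^ (4 : ℝ) ≤ ENNReal.ofReal ((2 * (q / p)) ^ 4) := by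
    rw [lintegral_sub_left_eq_self (fun r => far r ^ (4 : ℝ)) t]
    simp_rw [hfar4]
    rw [lintegral_far_rpow hRpos]
    apply ENNReal.ofReal_le_ofReal
    rw [hR, show 2 / (p / q) ^ 4 = 2 * (q / p) ^ 4 by field_simp, mul_pow]
    gcongr
    norm_num
  have hHolder : ∫⁻ s, h s * far (t - s) ≤ ENNReal.ofReal (p ^ 3 * (2 * (q / p))) := by
    have hconj : (4 / 3 : ℝ).HolderConjugate 4 := by
      rw [Real.holderConjugate_iff]; norm_num
    refine (ENNReal.lintegral_mul_le_Lp_mul_Lq volume hconj hh.aemeasurable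
      (mfar.comp (measurable_const.sub measurable_id)).aemeasurable).trans ?_
    rw [ENNReal.ofReal_mul (by positivity)]
    gcongr
    · rw [hN, ENNReal.ofReal_rpow_of_pos (by positivity), ← Real.rpow_natCast p 4,
        ← Real.rpow_mul hp.le, ← Real.rpow_natCast p 3]
      norm_num
    · refine (ENNReal.rpow_le_rpow hfarI (by norm_num)).trans_eq ?_
      rw [ENNReal.ofReal_rpow_of_pos (by positivity), ← Real.rpow_natCast _ 4,
        ← Real.rpow_mul (by positivity)]
      norm_num
  calc _ ≤ ∫⁻ s, (ENNReal.ofReal (q ^ 3) * near (t - s) + h s * far (t - s)) :=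
        lintegral_mono hpt
    _ = (ENNReal.ofReal (q ^ 3) * ∫⁻ s, near (t - s)) + ∫⁻ s, h s * far (t - s) := by
        rw [lintegral_add_left (by fun_prop), lintegral_const_mul' _ _ ENNReal.ofReal_ne_top]
    _ ≤ ENNReal.ofReal (q ^ 3) * ENNReal.ofReal (4 * (p / q) ^ 2)
        + ENNReal.ofReal (p ^ 3 * (2 * (q / p))) := by rw [hnearI]; gcongr
    _ = ENNReal.ofReal (6 * p ^ 2 * q) := by
        rw [← ENNReal.ofReal_mul (by positivity), ← ENNReal.ofReal_add (by positivity)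
          (by positivity)]
        congr 1
        field_simp
        ring

/-- The diagonal Hardy–Littlewood–Sobolev inequality for the kernel `|t - s|^{-1/2}`. -/
lemma lintegral_halfKernel_le {h : ℝ → ℝ≥0∞} (hh : Measurable h) (hfin : ∀ t, h t ≠ ∞)
    (hN : ∫⁻ s, h s ^ (4 / 3 : ℝ) ≠ ∞) :
    ∫⁻ z : ℝ × ℝ, h z.1 * h z.2 * halfKernel (z.1 - z.2)
      ≤ 12 * (∫⁻ s, h s ^ (4 / 3 : ℝ)) ^ (3 / 2 : ℝ) := by
  have hk := measurable_halfKernel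
  set N := ∫⁻ s, h s ^ (4 / 3 : ℝ) with hNdef
  rcases eq_or_ne N 0 with h0 | h0
  · have hae : ∀ᵐ s, h s = 0 := by
      have := (lintegral_eq_zero_iff (hh.pow_const (4 / 3 : ℝ))).mp h0
      filter_upwards [this] with s hs
      exact (ENNReal.rpow_eq_zero_iff_of_pos (by norm_num)).mp hs
    rw [Measure.volume_eq_prod, lintegral_prod _ (by fun_prop), lintegral_congr_ae (g := 0)]
    · simp
    · filter_upwards [hae] with s hs
      simp [hs]
  set p : ℝ := N.toReal ^ (1 / 4 : ℝ) with hp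
  have hNpos : 0 < N.toReal := ENNReal.toReal_pos h0 hN
  have hp0 : 0 < p := by positivity
  have hp4 : N = ENNReal.ofReal (p ^ 4) := by
    rw [hp, ← Real.rpow_natCast, ← Real.rpow_mul hNpos.le]
    norm_num [ENNReal.ofReal_toReal hN]
  have hinner : ∀ t, h t * ∫⁻ s, min (h s) (h t) * halfKernel (t - s)
      ≤ ENNReal.ofReal (6 * p ^ 2) * h t ^ (4 / 3 : ℝ) := by
    intro t
    rcases eq_or_ne (h t) 0 with ht | ht
    · simp [ht]
    have hpos : 0 < (h t).toReal := ENNReal.toReal_pos ht (hfin t)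
    set q : ℝ := (h t).toReal ^ (1 / 3 : ℝ) with hq
    have hq0 : 0 < q := by positivity
    have hq3 : h t = ENNReal.ofReal (q ^ 3) := by
      rw [hq, ← Real.rpow_natCast, ← Real.rpow_mul hpos.le]
      norm_num [ENNReal.ofReal_toReal (hfin t)]
    have key := lintegral_min_mul_halfKernel_le hh hp0 hq0 hp4 t
    calc _ ≤ ENNReal.ofReal (q ^ 3) * ENNReal.ofReal (6 * p ^ 2 * q) := by
          rw [← hq3] at key ⊢
          gcongr
      _ = _ := by
          rw [hq3, ENNReal.ofReal_rpow_of_pos (by positivity), ← ENNReal.ofReal_mul (by positivity),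
            ← ENNReal.ofReal_mul (by positivity), ← Real.rpow_natCast q 3, ← Real.rpow_mul hq0.le]
          norm_num
          congr 1
          ring
  have hm1 : Measurable fun z : ℝ × ℝ => h z.1 * (min (h z.2) (h z.1) * halfKernel (z.1 - z.2)) :=
    by fun_prop
  have hm2 : Measurable fun z : ℝ × ℝ => h z.2 * (min (h z.1) (h z.2) * halfKernel (z.2 - z.1)) :=
    by fun_prop
  have hI1 : ∫⁻ z : ℝ × ℝ, h z.1 * (min (h z.2) (h z.1) * halfKernel (z.1 - z.2))
      ≤ ENNReal.ofReal (6 * p ^ 2) * N := by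
    rw [Measure.volume_eq_prod, lintegral_prod _ hm1.aemeasurable, hNdef,
      ← lintegral_const_mul' _ _ ENNReal.ofReal_ne_top]
    refine lintegral_mono fun t => ?_
    simp only
    rw [lintegral_const_mul' _ _ (hfin t)]
    exact hinner t
  have hI2 : ∫⁻ z : ℝ × ℝ, h z.2 * (min (h z.1) (h z.2) * halfKernel (z.2 - z.1))
      ≤ ENNReal.ofReal (6 * p ^ 2) * N := by
    rw [Measure.volume_eq_prod, lintegral_prod_symm _ hm2.aemeasurable, hNdef,
      ← lintegral_const_mul' _ _ ENNReal.ofReal_ne_top]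
    refine lintegral_mono fun t => ?_
    simp only
    rw [lintegral_const_mul' _ _ (hfin t)]
    exact hinner t
  calc _ ≤ ∫⁻ z : ℝ × ℝ, (h z.1 * (min (h z.2) (h z.1) * halfKernel (z.1 - z.2))
          + h z.2 * (min (h z.1) (h z.2) * halfKernel (z.2 - z.1))) := by
        refine lintegral_mono fun z => ?_
        have hsymm : halfKernel (z.2 - z.1) = halfKernel (z.1 - z.2) := by
          unfold halfKernel; rw [abs_sub_comm]
        simp only
        rw [hsymm]
        rcases le_total (h z.1) (h z.2) with hle | hle
        · rw [min_eq_left hle]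
          exact le_add_left (by rw [mul_comm (h z.1), mul_assoc])
        · rw [min_eq_left hle]
          exact le_add_right (by rw [mul_assoc])
    _ ≤ ENNReal.ofReal (6 * p ^ 2) * N + ENNReal.ofReal (6 * p ^ 2) * N := by
        rw [lintegral_add_left hm1]
        gcongr
    _ = _ := by
        rw [hp4, ENNReal.ofReal_rpow_of_pos (by positivity), ← ENNReal.ofReal_mul (by positivity),
          ← ENNReal.ofReal_add (by positivity) (by positivity),
          show (12 : ℝ≥0∞) = ENNReal.ofReal 12 by simp, ← ENNReal.ofReal_mul (by positivity)]
        congr 1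
        rw [← Real.rpow_natCast p 4, ← Real.rpow_mul hp0.le,
          show ((4 : ℕ) : ℝ) * (3 / 2) = ((6 : ℕ) : ℝ) by norm_num, Real.rpow_natCast,
          Real.rpow_natCast]
        ring

lemma enorm_gaussKernel_le {ε : ℝ} (hε : 0 < ε) (x t : ℝ) :
    ‖gaussKernel ε x t‖ₑ ≤ ENNReal.ofReal (π ^ (1 / 2 : ℝ)) * halfKernel t := by
  have hpi : 0 < π ^ (1 / 2 : ℝ) := Real.rpow_pos_of_pos Real.pi_pos _
  rcases eq_or_ne t 0 with rfl | ht
  · have h0 : halfKernel 0 = ∞ := by simp [halfKernel]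
    rw [h0, ENNReal.mul_top (by simpa using hpi)]
    exact le_top
  · rw [halfKernel, ENNReal.ofReal_rpow_of_pos (abs_pos.mpr ht), ← ENNReal.ofReal_mul hpi.le,
      ← ofReal_norm]
    exact ENNReal.ofReal_le_ofReal (norm_gaussKernel_le hε x ht)

/-- The constant in the dual Strichartz estimate. -/
def dualConst : ℝ≥0∞ := ENNReal.ofReal (π ^ (1 / 2 : ℝ)) * 12

lemma dualConst_ne_top : dualConst ≠ ∞ := by unfold dualConst; finiteness

/-- The dual Strichartz estimate along a measurable curve `X`. -/
lemma lintegral_sq_chirpTransform_curve_le {w : ℝ → ℂ} (hwm : Measurable w) (hw : Integrable w)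
    (hN : ∫⁻ s, ‖w s‖ₑ ^ (4 / 3 : ℝ) ≠ ∞) {X : ℝ → ℝ} (hX : Measurable X) :
    ∫⁻ ξ, ‖chirpTransform volume w X id ξ‖ₑ ^ 2
      ≤ dualConst * (∫⁻ s, ‖w s‖ₑ ^ (4 / 3 : ℝ)) ^ (3 / 2 : ℝ) := by
  refine lintegral_le_of_forall_mul_gaussian_le
    ((aestronglyMeasurable_chirpTransform hw hX measurable_id).enorm.pow_const 2) fun ε hε => ?_
  refine (lintegral_sq_chirpTransform_mul_gaussian_le hw hX measurable_id hε).trans ?_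
  calc _ ≤ ∫⁻ z : ℝ × ℝ, ENNReal.ofReal (π ^ (1 / 2 : ℝ))
          * (‖w z.1‖ₑ * ‖w z.2‖ₑ * halfKernel (z.1 - z.2)) := by
        refine lintegral_mono fun z => ?_
        simp only [id]
        rw [mul_left_comm]
        gcongr
        exact enorm_gaussKernel_le hε _ _
    _ ≤ _ := by
        rw [lintegral_const_mul' _ _ ENNReal.ofReal_ne_top, dualConst, mul_assoc]
        gcongr
        exact lintegral_halfKernel_le hwm.enorm (fun t => enorm_ne_top) hN

/-- The solution `∫ e^{i(xξ - tξ²)} g(ξ) dξ` of the free Schrödinger equation. -/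
def schrodingerWave (g : ℝ → ℂ) (t x : ℝ) : ℂ := ∫ ξ : ℝ, g ξ * chirp x t ξ

lemma norm_schrodingerWave_le (g : ℝ → ℂ) (t x : ℝ) :
    ‖schrodingerWave g t x‖ ≤ ∫ ξ, ‖g ξ‖ := by
  refine (norm_integral_le_integral_norm _).trans_eq ?_
  simp [norm_chirp]

lemma measurable_schrodingerWave {α : Type*} [MeasurableSpace α] {g : α → ℝ → ℂ} {t x : α → ℝ}
    (hg : Measurable (Function.uncurry g)) (ht : Measurable t) (hx : Measurable x) :
    Measurable fun z => schrodingerWave (g z) (t z) (x z) := by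
  refine (StronglyMeasurable.integral_prod_right (ν := volume) (f := fun z ξ =>
    g z ξ * chirp (x z) (t z) ξ) (Measurable.stronglyMeasurable ?_)).measurable
  exact hg.mul (measurable_chirp (hx.comp measurable_fst) (ht.comp measurable_fst) measurable_snd)

lemma continuous_schrodingerWave {g : ℝ → ℂ} (hg : Integrable g) (t : ℝ) :
    Continuous (schrodingerWave g t) := by
  refine continuous_of_dominated (bound := fun ξ => ‖g ξ‖) (fun x => ?_) (fun x => ?_) hg.norm ?_
  · exact hg.aestronglyMeasurable.mul
      (measurable_chirp measurable_const measurable_const measurable_id).aestronglyMeasurable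
  · exact Filter.Eventually.of_forall fun ξ => by simp [norm_chirp]
  · refine Filter.Eventually.of_forall fun ξ => ?_
    unfold chirp
    fun_prop

lemma ENNReal.le_sq_of_le_rpow_mul_rpow {A B C : ℝ≥0∞} (hA : A ≠ ∞)
    (h : A ≤ B ^ (1 / 2 : ℝ) * (C * A ^ (3 / 2 : ℝ)) ^ (1 / 2 : ℝ)) : A ≤ (C * B) ^ 2 := by
  rcases eq_or_ne A 0 with rfl | h0
  · exact zero_le
  have h2 := ENNReal.rpow_le_rpow h (z := 2) (by norm_num)
  rw [← ENNReal.mul_rpow_of_nonneg _ _ (by norm_num), ← ENNReal.rpow_mul] at h2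
  norm_num at h2
  have e : A ^ 2 = A ^ (1 / 2 : ℝ) * A ^ (3 / 2 : ℝ) := by
    rw [← ENNReal.rpow_add _ _ h0 hA, ← ENNReal.rpow_natCast]
    norm_num
  rw [e, ← mul_assoc, mul_comm B C, ENNReal.mul_le_mul_iff_left (by simp [h0, hA])
    (by finiteness)] at h2
  calc A = (A ^ (1 / 2 : ℝ)) ^ 2 := by
        rw [← ENNReal.rpow_natCast, ← ENNReal.rpow_mul]; norm_num
    _ ≤ _ := by gcongr

/-- The `L⁴_t` Strichartz estimate along a measurable curve `X`, on a set of finite measure. -/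
lemma setLIntegral_schrodingerWave_curve_le {g : ℝ → ℂ} (hgm : Measurable g) (hg : Integrable g)
    {X : ℝ → ℝ} (hX : Measurable X) {E : Set ℝ} (hE : MeasurableSet E) (hEfin : volume E ≠ ∞) :
    ∫⁻ t in E, ‖schrodingerWave g t (X t)‖ₑ ^ 4 ≤ (dualConst * ∫⁻ ξ, ‖g ξ‖ₑ ^ 2) ^ 2 := by
  set f : ℝ → ℂ := fun t => schrodingerWave g t (X t) with hf
  have hfm : Measurable f := measurable_schrodingerWave (g := fun _ => g)
    (hgm.comp measurable_snd) measurable_id hX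
  set M : ℝ := ∫ ξ, ‖g ξ‖
  have hM : 0 ≤ M := integral_nonneg fun _ => norm_nonneg _
  have hfb : ∀ t, ‖f t‖ ≤ M := fun t => norm_schrodingerWave_le g t _
  set w : ℝ → ℂ := E.indicator fun t => (starRingEnd ℂ) (f t) * ((‖f t‖ ^ 2 : ℝ) : ℂ) with hw
  have hwm : Measurable w := by
    refine Measurable.indicator ?_ hE
    exact (Complex.continuous_conj.measurable.comp hfm).mul
      (Complex.measurable_ofReal.comp (hfm.norm.pow_const 2))
  have hwnorm : ∀ t, ‖w t‖ = E.indicator (fun t => ‖f t‖ ^ 3) t := by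
    intro t
    by_cases ht : t ∈ E
    · simp only [hw, Set.indicator_of_mem ht, norm_mul, RCLike.norm_conj, Complex.norm_real,
        norm_pow, norm_norm]
      ring
    · simp [hw, Set.indicator_of_notMem ht]
  have hwi : Integrable w := by
    have : Integrable (E.indicator fun _ => M ^ 3) :=
      (integrable_indicator_iff hE).mpr (integrableOn_const hEfin)
    refine this.mono' hwm.aestronglyMeasurable (Filter.Eventually.of_forall fun t => ?_)
    rw [hwnorm]
    exact Set.indicator_le_indicator (by gcongr; exact hfb t)
  set A : ℝ≥0∞ := ∫⁻ t in E, ‖f t‖ₑ ^ 4 with hA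
  have hwN : ∫⁻ s, ‖w s‖ₑ ^ (4 / 3 : ℝ) = A := by
    rw [hA, ← lintegral_indicator hE]
    congr 1
    ext t
    rw [← ofReal_norm, hwnorm]
    by_cases ht : t ∈ E
    · simp only [Set.indicator_of_mem ht]
      rw [ENNReal.ofReal_pow (norm_nonneg _), ofReal_norm, ← ENNReal.rpow_natCast,
        ← ENNReal.rpow_mul, ← ENNReal.rpow_natCast]
      norm_num
    · simp [Set.indicator_of_notMem ht]
  have hAfin : A ≠ ∞ := by
    refine ne_top_of_le_ne_top (b := ENNReal.ofReal M ^ 4 * volume E) (by finiteness) ?_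
    rw [hA, ← setLIntegral_const]
    refine lintegral_mono fun t => ?_
    gcongr
    rw [← ofReal_norm]
    exact ENNReal.ofReal_le_ofReal (hfb t)
  have hdual : A = ‖∫ t, w t * f t‖ₑ := by
    have h1 : ∀ t, w t * f t = ((E.indicator (fun t => ‖f t‖ ^ 4) t : ℝ) : ℂ) := by
      intro t
      by_cases ht : t ∈ E
      · simp only [hw, Set.indicator_of_mem ht]
        rw [mul_right_comm, mul_comm _ (f t), Complex.mul_conj, Complex.normSq_eq_norm_sq]
        push_cast
        ring
      · simp [hw, Set.indicator_of_notMem ht]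
    simp_rw [h1]
    have hi : Integrable (E.indicator fun t => ‖f t‖ ^ 4) := by
      have : Integrable (E.indicator fun _ => M ^ 4) :=
        (integrable_indicator_iff hE).mpr (integrableOn_const hEfin)
      refine this.mono' ((hfm.norm.pow_const 4).indicator hE).aestronglyMeasurable
        (Filter.Eventually.of_forall fun t => ?_)
      rw [Real.norm_of_nonneg (Set.indicator_nonneg (fun _ _ => by positivity) _)]
      exact Set.indicator_le_indicator (by gcongr; exact hfb t)
    have hnn : ∀ t, 0 ≤ E.indicator (fun t => ‖f t‖ ^ 4) t :=
      fun t => Set.indicator_nonneg (fun _ _ => by positivity) _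
    rw [integral_complex_ofReal, ← ofReal_norm, Complex.norm_of_nonneg (integral_nonneg hnn),
      ofReal_integral_eq_lintegral_ofReal hi (Filter.Eventually.of_forall hnn), hA,
      ← lintegral_indicator hE]
    congr 1
    ext t
    by_cases ht : t ∈ E
    · simp only [Set.indicator_of_mem ht]
      rw [ENNReal.ofReal_pow (norm_nonneg _), ofReal_norm]
    · simp [Set.indicator_of_notMem ht]
  have hswap : ∫ t, w t * f t = ∫ ξ, g ξ * chirpTransform volume w X id ξ := by
    have h1 : ∀ t, w t * f t = ∫ ξ, w t * (g ξ * chirp (X t) t ξ) := fun t =>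
      (integral_const_mul _ _).symm
    simp_rw [h1]
    rw [integral_integral_swap]
    · congr 1
      ext ξ
      rw [chirpTransform, ← integral_const_mul]
      congr 1
      ext t
      simp only [id]
      ring
    · have hch : Measurable fun z : ℝ × ℝ => chirp (X z.1) z.1 z.2 :=
        measurable_chirp (hX.comp measurable_fst) measurable_fst measurable_snd
      refine ((hwi.mul_prod hg).bdd_mul (c := 1) hch.aestronglyMeasurable
        (Filter.Eventually.of_forall fun q => (norm_chirp _ _ _).le)).congr
        (Filter.Eventually.of_forall fun q => ?_)
      simp only [Function.uncurry]
      ring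
  refine ENNReal.le_sq_of_le_rpow_mul_rpow hAfin ?_
  calc A = ‖∫ ξ, g ξ * chirpTransform volume w X id ξ‖ₑ := by rw [hdual, hswap]
    _ ≤ ∫⁻ ξ, ‖g ξ‖ₑ * ‖chirpTransform volume w X id ξ‖ₑ := by
        simpa only [enorm_mul] using enorm_integral_le_lintegral_enorm
          (fun ξ => g ξ * chirpTransform volume w X id ξ)
    _ ≤ (∫⁻ ξ, ‖g ξ‖ₑ ^ (2 : ℝ)) ^ (1 / 2 : ℝ)
        * (∫⁻ ξ, ‖chirpTransform volume w X id ξ‖ₑ ^ (2 : ℝ)) ^ (1 / 2 : ℝ) :=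
        ENNReal.lintegral_mul_le_Lp_mul_Lq volume Real.HolderConjugate.two_two
          hgm.enorm.aemeasurable
          (aestronglyMeasurable_chirpTransform hwi hX measurable_id).enorm
    _ ≤ _ := by
        simp only [ENNReal.rpow_two]
        gcongr
        have := lintegral_sq_chirpTransform_curve_le hwm hwi (by rwa [hwN]) hX
        rwa [hwN] at this

lemma exists_measurable_argmax {F : ℝ → ℝ → ℝ≥0∞} (hF : Measurable (Function.uncurry F))
    (q : ℕ → ℝ) (N : ℕ) :
    ∃ X : ℝ → ℝ, Measurable X ∧ ∀ t, ∀ n ≤ N, F t (q n) ≤ F t (X t) := by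
  induction N with
  | zero => exact ⟨fun _ => q 0, measurable_const, fun t n hn => by simp [Nat.le_zero.mp hn]⟩
  | succ N ih =>
    obtain ⟨X, hX, hle⟩ := ih
    have hm1 : Measurable fun t => F t (X t) := hF.comp (measurable_id.prodMk hX)
    have hm2 : Measurable fun t => F t (q (N + 1)) :=
      hF.comp (measurable_id.prodMk measurable_const)
    refine ⟨{t | F t (X t) < F t (q (N + 1))}.piecewise (fun _ => q (N + 1)) X,
      Measurable.piecewise (measurableSet_lt hm1 hm2) measurable_const hX, fun t n hn => ?_⟩
    by_cases ht : t ∈ {t | F t (X t) < F t (q (N + 1))}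
    · rw [Set.piecewise_eq_of_mem _ _ _ ht]
      rcases Nat.le_succ_iff.mp hn with h | h
      · exact (hle t n h).trans (le_of_lt ht)
      · rw [h]
    · rw [Set.piecewise_eq_of_notMem _ _ _ ht]
      rcases Nat.le_succ_iff.mp hn with h | h
      · exact hle t n h
      · rw [h]
        exact not_lt.mp ht

lemma lintegral_iSup_le_of_curves {F : ℝ → ℝ → ℝ≥0∞} (hF : Measurable (Function.uncurry F))
    (q : ℕ → ℝ) {B : ℝ≥0∞} (hB : ∀ X : ℝ → ℝ, Measurable X → ∀ T : ℝ,
      ∫⁻ t in Set.Icc (-T) T, F t (X t) ≤ B) : ∫⁻ t, ⨆ n, F t (q n) ≤ B := by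
  have hFq : ∀ n, Measurable fun t => F t (q n) := fun n =>
    hF.comp (measurable_id.prodMk measurable_const)
  set G : ℕ → ℝ → ℝ≥0∞ := fun N =>
    (Set.Icc (-(N : ℝ)) N).indicator fun t => ⨆ n, ⨆ (_ : n ≤ N), F t (q n) with hG
  have hGm : ∀ N, Measurable (G N) := fun N =>
    Measurable.indicator (.iSup fun n => .iSup fun _ => hFq n) measurableSet_Icc
  have hGmono : Monotone G := by
    intro N N' h t
    have hc : (N : ℝ) ≤ N' := by exact_mod_cast h
    refine (Set.indicator_le_indicator_of_subset (Set.Icc_subset_Icc (neg_le_neg hc) hc)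
      (fun _ => zero_le) t).trans (Set.indicator_le_indicator ?_)
    exact iSup_mono fun n => iSup_le fun hn => le_iSup_of_le (hn.trans h) le_rfl
  have hle : ∀ t, ⨆ n, F t (q n) ≤ ⨆ N, G N t := by
    intro t
    refine iSup_le fun n => ?_
    obtain ⟨m, hm⟩ := exists_nat_ge |t|
    refine le_iSup_of_le (max n m) ?_
    have hmem : t ∈ Set.Icc (-((max n m : ℕ) : ℝ)) (max n m : ℕ) := by
      rw [Set.mem_Icc, ← abs_le]
      exact hm.trans (by exact_mod_cast le_max_right _ _)
    simp only [hG, Set.indicator_of_mem hmem]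
    exact le_iSup_of_le n (le_iSup_of_le (le_max_left _ _) le_rfl)
  refine (lintegral_mono hle).trans ?_
  rw [lintegral_iSup hGm hGmono]
  refine iSup_le fun N => ?_
  obtain ⟨X, hX, hmax⟩ := exists_measurable_argmax hF q N
  refine le_trans ?_ (hB X hX N)
  rw [hG, lintegral_indicator measurableSet_Icc]
  exact lintegral_mono fun t => iSup_le fun n => iSup_le fun hn => hmax t n hn

/-- The scalar `L⁴_t L^∞_x` Strichartz estimate. -/
lemma lintegral_iSup_schrodingerWave_le {g : ℝ → ℂ} (hgm : Measurable g) (hg : Integrable g)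
    (q : ℕ → ℝ) :
    ∫⁻ t, ⨆ n, ‖schrodingerWave g t (q n)‖ₑ ^ 4 ≤ (dualConst * ∫⁻ ξ, ‖g ξ‖ₑ ^ 2) ^ 2 := by
  refine lintegral_iSup_le_of_curves (F := fun t x => ‖schrodingerWave g t x‖ₑ ^ 4)
    ?_ q fun X hX T => setLIntegral_schrodingerWave_curve_le hgm hg hX measurableSet_Icc
      (by simp)
  exact (measurable_schrodingerWave (g := fun _ => g) (hgm.comp measurable_snd)
    measurable_fst measurable_snd).enorm.pow_const 4

lemma enorm_schrodingerWave_pow_le_iSup {g : ℝ → ℂ} (hg : Integrable g) {q : ℕ → ℝ}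
    (hq : DenseRange q) (t x : ℝ) :
    ‖schrodingerWave g t x‖ₑ ^ 4 ≤ ⨆ n, ‖schrodingerWave g t (q n)‖ₑ ^ 4 := by
  have hc : Continuous fun x => ‖schrodingerWave g t x‖ₑ ^ 4 :=
    ENNReal.continuous_pow 4 |>.comp (continuous_schrodingerWave hg t).enorm
  exact hq.induction_on (p := fun x => ‖schrodingerWave g t x‖ₑ ^ 4
    ≤ ⨆ n, ‖schrodingerWave g t (q n)‖ₑ ^ 4) x (isClosed_le hc continuous_const)
    fun n => le_iSup (fun n => ‖schrodingerWave g t (q n)‖ₑ ^ 4) n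

/-- Minkowski's integral inequality in `L²(L¹)`. -/
lemma lintegral_sq_lintegral_le {S : ℝ → ℝ → ℝ≥0∞} (hS : Measurable (Function.uncurry S)) :
    ∫⁻ t, (∫⁻ η, S t η) ^ 2 ≤ (∫⁻ η, (∫⁻ t, S t η ^ 2) ^ (1 / 2 : ℝ)) ^ 2 := by
  have hSt : ∀ t, Measurable (S t) := fun t => hS.comp measurable_prodMk_left
  have hSη : ∀ η, Measurable fun t => S t η := fun η => hS.comp measurable_prodMk_right
  set n : ℝ → ℝ≥0∞ := fun η => (∫⁻ t, S t η ^ 2) ^ (1 / 2 : ℝ) with hn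
  have hnm : Measurable n :=
    (Measurable.lintegral_prod_left' (f := fun z : ℝ × ℝ => S z.1 z.2 ^ 2)
      (hS.pow_const 2)).pow_const _
  have hsq : ∀ f : ℝ → ℝ≥0∞, Measurable f →
      (∫⁻ η, f η) ^ 2 = ∫⁻ p : ℝ × ℝ, f p.1 * f p.2 := by
    intro f hf
    rw [sq, ← lintegral_prod_mul hf.aemeasurable hf.aemeasurable, Measure.volume_eq_prod]
  rw [hsq n hnm]
  simp_rw [hsq _ (hSt _)]
  rw [lintegral_lintegral_swap]
  · refine lintegral_mono fun p => ?_
    refine (ENNReal.lintegral_mul_le_Lp_mul_Lq volume Real.HolderConjugate.two_two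
      (hSη p.1).aemeasurable (hSη p.2).aemeasurable).trans_eq ?_
    simp only [ENNReal.rpow_two, hn]
  · refine Measurable.aemeasurable ?_
    exact (hS.comp (measurable_fst.prodMk (measurable_fst.comp measurable_snd))).mul
      (hS.comp (measurable_fst.prodMk (measurable_snd.comp measurable_snd)))

section Wave

variable {g : ℝ × ℝ → ℂ}

lemma measurable_wave_param (hgm : Measurable g) {α : Type*} [MeasurableSpace α]
    {t x η : α → ℝ} (ht : Measurable t) (hx : Measurable x) (hη : Measurable η) :
    Measurable fun z => schrodingerWave (fun ξ => g (ξ, η z)) (t z) (x z) :=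
  measurable_schrodingerWave (g := fun z ξ => g (ξ, η z))
    (hgm.comp (measurable_snd.prodMk (hη.comp measurable_fst))) ht hx

/-- A majorant of `sup_x ∫ |W(t, x, η)|² dη`. -/
def waveMajorant (g : ℝ × ℝ → ℂ) (t : ℝ) : ℝ≥0∞ :=
  ∫⁻ η, (⨆ n, ‖schrodingerWave (fun ξ => g (ξ, η)) t (TopologicalSpace.denseSeq ℝ n)‖ₑ ^ 4)
    ^ (1 / 2 : ℝ)

lemma lintegral_sq_wave_le_waveMajorant (hg : Integrable g) (t x : ℝ) :
    ∫⁻ η, ‖schrodingerWave (fun ξ => g (ξ, η)) t x‖ₑ ^ 2 ≤ waveMajorant g t := by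
  rw [Measure.volume_eq_prod] at hg
  refine lintegral_mono_ae ?_
  filter_upwards [hg.prod_left_ae] with η hη
  have h := ENNReal.rpow_le_rpow (enorm_schrodingerWave_pow_le_iSup hη
    (TopologicalSpace.denseRange_denseSeq ℝ) t x) (z := 1 / 2) (by norm_num)
  refine le_trans (le_of_eq ?_) h
  rw [← ENNReal.rpow_natCast, ← ENNReal.rpow_natCast, ← ENNReal.rpow_mul]
  norm_num

lemma measurable_waveMajorant_integrand (hgm : Measurable g) :
    Measurable (Function.uncurry fun t η : ℝ =>
      (⨆ n, ‖schrodingerWave (fun ξ => g (ξ, η)) t (TopologicalSpace.denseSeq ℝ n)‖ₑ ^ 4)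
        ^ (1 / 2 : ℝ)) :=
  (Measurable.iSup fun _ => (measurable_wave_param hgm measurable_fst measurable_const
    measurable_snd).enorm.pow_const 4).pow_const _

lemma measurable_waveMajorant (hgm : Measurable g) : Measurable (waveMajorant g) :=
  (measurable_waveMajorant_integrand hgm).lintegral_prod_right

lemma lintegral_sq_waveMajorant_le (hgm : Measurable g) (hg : Integrable g) :
    ∫⁻ t, waveMajorant g t ^ 2 ≤ (dualConst * ∫⁻ p, ‖g p‖ₑ ^ 2) ^ 2 := by
  refine (lintegral_sq_lintegral_le (measurable_waveMajorant_integrand hgm)).trans ?_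
  gcongr
  have hg' := hg
  rw [Measure.volume_eq_prod] at hg'
  rw [Measure.volume_eq_prod, lintegral_prod_symm' _ (hgm.enorm.pow_const 2),
    ← lintegral_const_mul' _ _ dualConst_ne_top]
  refine lintegral_mono_ae ?_
  filter_upwards [hg'.prod_left_ae] with η hη
  have h := lintegral_iSup_schrodingerWave_le (hgm.comp measurable_prodMk_right) hη
    (TopologicalSpace.denseSeq ℝ)
  have h2 := ENNReal.rpow_le_rpow h (z := 1 / 2) (by norm_num)
  refine le_trans (le_of_eq ?_) (h2.trans_eq ?_)
  · congr 2
    ext t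
    rw [← ENNReal.rpow_natCast, ← ENNReal.rpow_mul]
    norm_num
    rfl
  · rw [← ENNReal.rpow_natCast, ← ENNReal.rpow_mul]
    norm_num

lemma chirp_eq_mul (x t ξ : ℝ) : chirp x t ξ = chirp 0 t ξ * chirp ξ 0 x := by
  unfold chirp
  rw [← Complex.exp_add]
  congr 1
  push_cast
  ring

lemma integrable_mul_chirp {f : ℝ → ℂ} (hf : Integrable f) (x t : ℝ) :
    Integrable fun ξ => f ξ * chirp x t ξ := by
  refine (hf.bdd_mul (c := 1) (measurable_chirp measurable_const measurable_const
    measurable_id).aestronglyMeasurable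
    (Filter.Eventually.of_forall fun ξ => (norm_chirp x t ξ).le)).congr
    (Filter.Eventually.of_forall fun ξ => mul_comm _ _)

lemma lintegral_sq_schrodingerWave_le {f : ℝ → ℂ} (hf : Integrable f) (t : ℝ) :
    ∫⁻ x, ‖schrodingerWave f t x‖ₑ ^ 2 ≤ ENNReal.ofReal (2 * π) * ∫⁻ ξ, ‖f ξ‖ₑ ^ 2 := by
  have h := lintegral_sq_fourier_le (integrable_mul_chirp hf 0 t)
  simp_rw [mul_assoc, ← chirp_eq_mul, enorm_mul, enorm_chirp, mul_one] at h
  exact h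

lemma lintegral_lintegral_sq_wave_le (hgm : Measurable g) (hg : Integrable g) (t : ℝ) :
    ∫⁻ x, ∫⁻ η, ‖schrodingerWave (fun ξ => g (ξ, η)) t x‖ₑ ^ 2
      ≤ ENNReal.ofReal (2 * π) * ∫⁻ p, ‖g p‖ₑ ^ 2 := by
  rw [lintegral_lintegral_swap ((measurable_wave_param hgm measurable_const measurable_fst
    measurable_snd).enorm.pow_const 2).aemeasurable, Measure.volume_eq_prod,
    lintegral_prod_symm' _ (hgm.enorm.pow_const 2),
    ← lintegral_const_mul' _ _ ENNReal.ofReal_ne_top]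
  rw [Measure.volume_eq_prod] at hg
  refine lintegral_mono_ae ?_
  filter_upwards [hg.prod_left_ae] with η hη
  exact lintegral_sq_schrodingerWave_le hη t

end Wave

lemma enorm_toReal_le (x : ℝ≥0∞) : ‖x.toReal‖ₑ ≤ x := by
  rw [Real.enorm_eq_ofReal ENNReal.toReal_nonneg]
  exact ENNReal.ofReal_toReal_le

/-- Interpolation of the mixed norm on the admissible line between `L^∞ L²` and `L⁴ L^∞`. -/
lemma eLpNorm_eLpNorm_le_of_endpoints {k l : ℝ≥0∞} (hk : 2 < k) (hl : 2 ≤ l)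
    (hadm : 2 / k + 1 / l = 1 / 2) {m : ℝ → ℝ → ℝ} {a : ℝ → ℝ≥0∞} (ha : Measurable a)
    {K : ℝ≥0∞} (h1 : ∀ t, ∫⁻ x, ‖m t x‖ₑ ^ 2 ≤ K ^ 2)
    (h2 : ∀ t x, ‖m t x‖ₑ ^ 2 ≤ a t)
    (h3 : ∫⁻ t, a t ^ 2 ≤ K ^ 4) :
    eLpNorm (fun t => (eLpNorm (m t) l volume).toReal) k volume ≤ K := by
  rcases eq_or_ne K ∞ with rfl | hK
  · exact le_top
  have hk0 : k ≠ 0 := (lt_trans (by norm_num) hk).ne'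
  have hl0 : l ≠ 0 := (lt_of_lt_of_le (by norm_num) hl).ne'
  have h2' : ∀ t x, ‖m t x‖ₑ ≤ a t ^ (1 / 2 : ℝ) := by
    intro t x
    have := ENNReal.rpow_le_rpow (h2 t x) (z := 1 / 2) (by norm_num)
    rw [← ENNReal.rpow_natCast, ← ENNReal.rpow_mul] at this
    norm_num at this
    simpa using this
  rcases eq_or_ne k ∞ with rfl | hktop
  · have hl2 : l = 2 := by
      simpa using hadm
    subst hl2
    rw [eLpNorm_exponent_top]
    refine eLpNormEssSup_le_of_ae_enorm_bound (Filter.Eventually.of_forall fun t => ?_)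
    refine (enorm_toReal_le _).trans ?_
    rw [eLpNorm_eq_lintegral_rpow_enorm_toReal (by norm_num) (by norm_num)]
    have := ENNReal.rpow_le_rpow (h1 t) (z := 1 / 2) (by norm_num)
    rw [← ENNReal.rpow_natCast K, ← ENNReal.rpow_mul] at this
    norm_num at this
    simpa using this
  set κ := k.toReal with hκ
  have hκpos : 0 < κ := ENNReal.toReal_pos hk0 hktop
  rw [eLpNorm_eq_lintegral_rpow_enorm_toReal hk0 hktop, ← hκ]
  suffices h : ∫⁻ t, ‖(eLpNorm (m t) l volume).toReal‖ₑ ^ κ ≤ K ^ κ by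
    refine (ENNReal.rpow_le_rpow h (by positivity)).trans_eq ?_
    rw [← ENNReal.rpow_mul, mul_one_div_cancel hκpos.ne', ENNReal.rpow_one]
  rcases eq_or_ne l ∞ with rfl | hltop
  · have hκ4 : κ = 4 := by
      have := congrArg ENNReal.toReal hadm
      rw [ENNReal.toReal_add (by simp [ENNReal.div_eq_top, hk0]) (by simp)] at this
      simp [ENNReal.toReal_div, ← hκ] at this
      field_simp at this
      linarith
    refine le_trans (lintegral_mono fun t => ?_) (h3.trans_eq ?_)
    · calc ‖(eLpNorm (m t) ∞ volume).toReal‖ₑ ^ κ ≤ (a t ^ (1 / 2 : ℝ)) ^ κ := by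
            gcongr
            refine (enorm_toReal_le _).trans ?_
            rw [eLpNorm_exponent_top]
            exact eLpNormEssSup_le_of_ae_enorm_bound (Filter.Eventually.of_forall (h2' t))
        _ = a t ^ 2 := by
            rw [hκ4, ← ENNReal.rpow_mul, ← ENNReal.rpow_natCast]
            norm_num
    · rw [hκ4, ← ENNReal.rpow_natCast]
      norm_num
  set r := l.toReal with hr
  have hrpos : 0 < r := ENNReal.toReal_pos hl0 hltop
  have hr2 : 2 ≤ r := by
    have := ENNReal.toReal_mono hltop hl
    simpa using this
  have hrel : 2 / κ + 1 / r = 1 / 2 := by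
    have := congrArg ENNReal.toReal hadm
    rw [ENNReal.toReal_add (by simp [ENNReal.div_eq_top, hk0])
      (by simp [hl0])] at this
    simpa [ENNReal.toReal_div, ← hκ, ← hr] using this
  have hfin : ∀ᵐ t, a t ≠ ∞ := by
    filter_upwards [ae_lt_top (ha.pow_const 2)
      (ne_top_of_le_ne_top (ENNReal.pow_ne_top hK) h3)] with t ht h
    simp [h] at ht
  have hinner : ∀ t, a t ≠ ∞ → eLpNorm (m t) l volume
      ≤ (a t ^ ((r - 2) / 2) * K ^ 2) ^ (1 / r) := by
    intro t hat
    rw [eLpNorm_eq_lintegral_rpow_enorm_toReal hl0 hltop, ← hr]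
    gcongr
    calc ∫⁻ x, ‖m t x‖ₑ ^ r ≤ ∫⁻ x, a t ^ ((r - 2) / 2) * ‖m t x‖ₑ ^ 2 := by
          refine lintegral_mono fun x => ?_
          calc ‖m t x‖ₑ ^ r = ‖m t x‖ₑ ^ (r - 2) * ‖m t x‖ₑ ^ (2 : ℝ) := by
                rw [← ENNReal.rpow_add_of_nonneg _ _ (by linarith) (by norm_num)]
                congr 1; ring
            _ ≤ (a t ^ (1 / 2 : ℝ)) ^ (r - 2) * ‖m t x‖ₑ ^ (2 : ℝ) := by
                have : 0 ≤ r - 2 := by linarith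
                gcongr
                exact h2' t x
            _ = _ := by
                rw [← ENNReal.rpow_mul, ENNReal.rpow_two]
                congr 2; ring
      _ = a t ^ ((r - 2) / 2) * ∫⁻ x, ‖m t x‖ₑ ^ 2 :=
          lintegral_const_mul' _ _ (ENNReal.rpow_ne_top_of_nonneg (by linarith) hat)
      _ ≤ _ := by gcongr; exact h1 t
  have e1 : (r - 2) / 2 * (1 / r) * κ = 2 := by
    field_simp at hrel ⊢
    linarith
  have e2 : 2 * (1 / r) * κ = κ - 4 := by
    field_simp at hrel ⊢
    linarith
  have hκ4 : 0 ≤ κ - 4 := by rw [← e2]; positivity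
  calc ∫⁻ t, ‖(eLpNorm (m t) l volume).toReal‖ₑ ^ κ
      ≤ ∫⁻ t, a t ^ 2 * K ^ (κ - 4) := by
        refine lintegral_mono_ae ?_
        filter_upwards [hfin] with t hat
        calc _ ≤ ((a t ^ ((r - 2) / 2) * K ^ 2) ^ (1 / r)) ^ κ := by
              gcongr
              exact (enorm_toReal_le _).trans (hinner t hat)
          _ = _ := by
              rw [← ENNReal.rpow_mul, ENNReal.mul_rpow_of_nonneg _ _ (by positivity),
                ← ENNReal.rpow_natCast K 2, ← ENNReal.rpow_mul, ← ENNReal.rpow_mul, ← mul_assoc,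
                ← mul_assoc, e1, Nat.cast_ofNat, e2, ENNReal.rpow_two]
    _ ≤ K ^ 4 * K ^ (κ - 4) := by
        rw [lintegral_mul_const' _ _ (ENNReal.rpow_ne_top_of_nonneg hκ4 hK)]
        gcongr
    _ = K ^ κ := by
        rw [← ENNReal.rpow_natCast, ← ENNReal.rpow_add_of_nonneg _ _ (by positivity) hκ4]
        congr 1
        push_cast
        ring

lemma integrable_mul_chirp_fst {g : ℝ × ℝ → ℂ} (hg : Integrable g) (t x : ℝ) :
    Integrable fun p : ℝ × ℝ => g p * chirp x t p.1 :=
  hg.mul_bdd (c := 1) (measurable_chirp measurable_const measurable_const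
    measurable_fst).aestronglyMeasurable (ae_of_all _ fun _ => (norm_chirp _ _ _).le)

lemma integrable_wave_param {g : ℝ × ℝ → ℂ} (hg : Integrable g) (t x : ℝ) :
    Integrable fun η => schrodingerWave (fun ξ => g (ξ, η)) t x :=
  (integrable_mul_chirp_fst hg t x).integral_prod_right

lemma FT2_eq_schrodingerWave (f : ℝ × ℝ → ℂ) (ξ η : ℝ) :
    FT2 (fun a b => f (a, b)) ξ η =
      schrodingerWave (fun x => schrodingerWave (fun y => f (x, y)) 0 (-η)) 0 (-ξ) := by
  unfold FT2 schrodingerWave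
  congr 1 with x
  rw [← integral_mul_const]
  congr 1 with y
  rw [mul_comm, mul_assoc, chirp, chirp, ← Complex.exp_add]
  congr 2
  push_cast
  ring

/-- Bessel's inequality for the Fourier transform on `ℝ²`. -/
lemma lintegral_sq_FT2_le {f : ℝ × ℝ → ℂ} (hfm : Measurable f) (hf : Integrable f) :
    ∫⁻ η, ∫⁻ ξ, ‖FT2 (fun a b => f (a, b)) ξ η‖ₑ ^ 2
      ≤ ENNReal.ofReal (2 * π) * (ENNReal.ofReal (2 * π) * ∫⁻ p, ‖f p‖ₑ ^ 2) := by
  have hfs : Integrable fun p : ℝ × ℝ => f p.swap := hf.swap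
  have hfms : Measurable fun p : ℝ × ℝ => f p.swap := hfm.comp measurable_swap
  calc ∫⁻ η, ∫⁻ ξ, ‖FT2 (fun a b => f (a, b)) ξ η‖ₑ ^ 2
      ≤ ∫⁻ η, ENNReal.ofReal (2 * π) *
          ∫⁻ x, ‖schrodingerWave (fun y => f (x, y)) 0 (-η)‖ₑ ^ 2 := by
        refine lintegral_mono fun η => ?_
        simp_rw [FT2_eq_schrodingerWave]
        rw [lintegral_neg_eq_self (fun ξ => ‖schrodingerWave (fun x =>
          schrodingerWave (fun y => f (x, y)) 0 (-η)) 0 ξ‖ₑ ^ 2)]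
        exact lintegral_sq_schrodingerWave_le (integrable_wave_param hfs 0 (-η)) 0
    _ = ENNReal.ofReal (2 * π) *
          ∫⁻ η, ∫⁻ x, ‖schrodingerWave (fun y => f (x, y)) 0 η‖ₑ ^ 2 := by
        rw [lintegral_const_mul' _ _ ENNReal.ofReal_ne_top,
          lintegral_neg_eq_self (fun η => ∫⁻ x, ‖schrodingerWave (fun y => f (x, y)) 0 η‖ₑ ^ 2)]
    _ ≤ _ := by
        gcongr
        refine (lintegral_lintegral_sq_wave_le hfms hfs 0).trans_eq ?_
        rw [Measure.volume_eq_prod, lintegral_prod_swap (fun p => ‖f p‖ₑ ^ 2)]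

/-- The Fourier transform of a Schwartz function on `ℝ²` is a Schwartz function. -/
lemma exists_schwartzMap_eq_FT2 (Γ : 𝓢(ℝ × ℝ, ℂ)) :
    ∃ ψ : 𝓢(ℝ × ℝ, ℂ), ∀ ξ η, FT2 (fun a b => Γ (a, b)) ξ η = ψ (ξ, η) := by
  let e := WithLp.prodContinuousLinearEquiv 2 ℝ ℝ ℝ
  let s : (ℝ × ℝ) ≃L[ℝ] ℝ × ℝ :=
    ContinuousLinearEquiv.smulLeft (Units.mk0 ((2 * π)⁻¹ : ℝ) (by positivity))
  let Φ := SchwartzMap.compCLMOfContinuousLinearEquiv ℂ e Γ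
  refine ⟨SchwartzMap.compCLMOfContinuousLinearEquiv ℂ (s.trans e.symm) (FourierTransform.fourier Φ),
    fun ξ η => ?_⟩
  have hInt : Integrable fun p : ℝ × ℝ =>
      Complex.exp (-(Complex.I) * ((ξ : ℂ) * p.1 + (η : ℂ) * p.2)) * Γ p := by
    refine Γ.integrable.bdd_mul (c := 1) (by fun_prop) (ae_of_all _ fun p => ?_)
    rw [show -(Complex.I) * ((ξ : ℂ) * p.1 + (η : ℂ) * p.2)
      = ((-(ξ * p.1 + η * p.2) : ℝ) : ℂ) * Complex.I by push_cast; ring,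
      Complex.norm_exp_ofReal_mul_I]
  rw [Measure.volume_eq_prod] at hInt
  rw [SchwartzMap.compCLMOfContinuousLinearEquiv_apply, Function.comp_apply,
    SchwartzMap.fourier_coe, Real.fourier_eq]
  unfold FT2
  rw [← integral_prod _ hInt, ← Measure.volume_eq_prod,
    ← (WithLp.volume_preserving_ofLp ℝ ℝ).integral_comp
      (MeasurableEquiv.toLp 2 (ℝ × ℝ)).symm.measurableEmbedding]
  congr 1 with v
  have hv : inner ℝ v ((s.trans e.symm) (ξ, η)) = (2 * π)⁻¹ * (ξ * v.fst + η * v.snd) := by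
    simp only [WithLp.prod_inner_apply]
    change ((2 * π)⁻¹ * ξ) * v.fst + ((2 * π)⁻¹ * η) * v.snd = _
    ring
  have hπ : (π : ℂ) ≠ 0 := Complex.ofReal_ne_zero.2 Real.pi_ne_zero
  rw [hv, Circle.smul_def, Real.fourierChar_apply, smul_eq_mul]
  congr 2
  push_cast
  field_simp
  rfl

lemma freeGamma_eq_schrodingerWave {f : ℝ → ℝ → ℂ} {g : ℝ × ℝ → ℂ} (hg : Integrable g)
    (hfg : ∀ ξ η, FT2 f ξ η = g (ξ, η)) (t x y : ℝ) :
    freeGamma f t x y = ((2 * (Real.pi : ℂ)) ^ 2)⁻¹ *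
      schrodingerWave (fun η => schrodingerWave (fun ξ => g (ξ, η)) t x) (-t) y := by
  unfold freeGamma IFT2 schrodingerWave
  congr 1
  have hInt : Integrable (Function.uncurry fun ξ η => g (ξ, η) * chirp x t ξ * chirp y (-t) η)
      (volume.prod volume) :=
    (integrable_mul_chirp_fst hg t x).mul_bdd (c := 1) (measurable_chirp measurable_const
      measurable_const measurable_snd).aestronglyMeasurable
      (ae_of_all _ fun _ => (norm_chirp _ _ _).le)
  simp_rw [← integral_mul_const]
  rw [← integral_integral_swap hInt]
  congr 1 with ξ
  congr 1 with η
  rw [hfg, ← mul_assoc, mul_comm, chirp, chirp, mul_assoc (g _), ← Complex.exp_add,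
    ← Complex.exp_add]
  congr 2
  push_cast
  ring

lemma lintegral_sq_freeGamma_le {f : ℝ → ℝ → ℂ} {g : ℝ × ℝ → ℂ} (hg : Integrable g)
    (hfg : ∀ ξ η, FT2 f ξ η = g (ξ, η)) (t x : ℝ) :
    ∫⁻ y, ‖freeGamma f t x y‖ₑ ^ 2 ≤ ‖((2 * (Real.pi : ℂ)) ^ 2)⁻¹‖ₑ ^ 2 *
      (ENNReal.ofReal (2 * π) * ∫⁻ η, ‖schrodingerWave (fun ξ => g (ξ, η)) t x‖ₑ ^ 2) := by
  simp_rw [freeGamma_eq_schrodingerWave hg hfg, enorm_mul, mul_pow]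
  rw [lintegral_const_mul' _ _ (by finiteness)]
  gcongr
  exact lintegral_sq_schrodingerWave_le (integrable_wave_param hg t x) (-t)

lemma eLpNorm_two_sq {α : Type*} [MeasurableSpace α] {μ : Measure α} (f : α → ℂ) :
    eLpNorm f 2 μ ^ 2 = ∫⁻ x, ‖f x‖ₑ ^ 2 ∂μ := by
  simpa using eLpNorm_nnreal_pow_eq_lintegral (μ := μ) (f := f) (p := 2) two_ne_zero

/-- Non-endpoint Strichartz estimate for the free von-Neumann Schrödinger flow. -/
theorem strichartz_free_vonNeumann (k l : ℝ≥0∞) (hk : 2 < k) (hl : 2 ≤ l)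
    (hadm : 2 / k + 1 / l = 1 / 2) :
    ∃ C : ℝ, 0 < C ∧ ∀ Γ₀ : 𝓢(ℝ × ℝ, ℂ),
      MixedN3 volume k l 2 (freeGamma (fun a b => Γ₀ (a, b)))
        ≤ ENNReal.ofReal C * L2K (fun a b => Γ₀ (a, b)) := by
  set c : ℝ≥0∞ := ENNReal.ofReal (2 * π) with hc
  set κ : ℝ≥0∞ := ‖((2 * (Real.pi : ℂ)) ^ 2)⁻¹‖ₑ ^ 2 * c with hκ
  set A : ℝ≥0∞ := 1 + κ * (c + dualConst) * (c * c) with hA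
  have hAtop : A ≠ ∞ := by
    have := dualConst_ne_top
    finiteness
  have hA1 : 1 ≤ A := le_self_add
  have hAA : κ * (c + dualConst) * (c * c) ≤ A ^ 2 := le_add_self.trans (le_self_pow hA1 two_ne_zero)
  refine ⟨A.toReal, ENNReal.toReal_pos (zero_lt_one.trans_le hA1).ne' hAtop, fun Γ₀ => ?_⟩
  obtain ⟨ψ, hψ⟩ := exists_schwartzMap_eq_FT2 Γ₀
  have hψm : Measurable ψ := ψ.continuous.measurable
  have hψi : Integrable ψ := ψ.integrable
  set D := L2K (fun a b => Γ₀ (a, b)) with hD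
  have hψD : ∫⁻ p, ‖ψ p‖ₑ ^ 2 ≤ c * c * D ^ 2 := by
    have h := lintegral_sq_FT2_le Γ₀.continuous.measurable Γ₀.integrable
    simp_rw [hψ] at h
    rw [← eLpNorm_two_sq] at h
    rw [Measure.volume_eq_prod, lintegral_prod_symm' _ (by fun_prop), mul_assoc]
    exact h
  have hm : ∀ t x, ‖(eLpNorm (freeGamma (fun a b => Γ₀ (a, b)) t x) 2 volume).toReal‖ₑ ^ 2
      ≤ κ * ∫⁻ η, ‖schrodingerWave (fun ξ => ψ (ξ, η)) t x‖ₑ ^ 2 := fun t x => by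
    refine (pow_le_pow_left' (enorm_toReal_le _) 2).trans ?_
    rw [eLpNorm_two_sq, hκ, mul_assoc]
    exact lintegral_sq_freeGamma_le hψi hψ t x
  rw [ENNReal.ofReal_toReal hAtop]
  refine eLpNorm_eLpNorm_le_of_endpoints hk hl hadm (a := fun t => κ * waveMajorant ψ t)
    ((measurable_waveMajorant hψm).const_mul κ) (fun t => ?_) (fun t x => ?_) ?_
  · calc _ ≤ ∫⁻ x, κ * ∫⁻ η, ‖schrodingerWave (fun ξ => ψ (ξ, η)) t x‖ₑ ^ 2 :=
          lintegral_mono fun x => hm t x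
      _ ≤ κ * (c * (c * c * D ^ 2)) := by
          rw [lintegral_const_mul' _ _ (by finiteness)]
          gcongr
          exact (lintegral_lintegral_sq_wave_le hψm hψi t).trans (by gcongr)
      _ = κ * c * (c * c) * D ^ 2 := by ring
      _ ≤ κ * (c + dualConst) * (c * c) * D ^ 2 := by gcongr; exact le_self_add
      _ ≤ A ^ 2 * D ^ 2 := by gcongr
      _ = (A * D) ^ 2 := by ring
  · exact (hm t x).trans (by gcongr; exact lintegral_sq_wave_le_waveMajorant hψi t x)
  · calc ∫⁻ t, (κ * waveMajorant ψ t) ^ 2 = κ ^ 2 * ∫⁻ t, waveMajorant ψ t ^ 2 := by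
          simp_rw [mul_pow]
          rw [lintegral_const_mul' _ _ (by finiteness)]
      _ ≤ κ ^ 2 * (dualConst * (c * c * D ^ 2)) ^ 2 := by
          gcongr
          exact (lintegral_sq_waveMajorant_le hψm hψi).trans (by gcongr)
      _ = (κ * dualConst * (c * c) * D ^ 2) ^ 2 := by ring
      _ ≤ (κ * (c + dualConst) * (c * c) * D ^ 2) ^ 2 := by gcongr; exact le_add_self
      _ ≤ (A ^ 2 * D ^ 2) ^ 2 := by gcongr
      _ = (A * D) ^ 4 := by ring

end
end
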